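/- Suppose q ≡ 3 (mod 8). Then for every irreducible complex character χ of G with χ(1) = (q−1)/2, Γ(χ) = (m−1)/2. -/

import Mathlib

open scoped BigOperators Classical

noncomputable section

/-- The projective special linear group `PSL(2, F) = SL(2, F)/{±I}` (for `F` a finite
field of odd characteristic the center of `SL(2,F)` is exactly `{±I}`). -/
abbrev PSL2 (F : Type) [Field F] : Type :=
  Matrix.SpecialLinearGroup (Fin 2) F ⧸ Subgroup.center (Matrix.SpecialLinearGroup (Fin 2) F)

/-- `χ` is the character of some finite-dimensional complex representation of `G`. -/
def IsCharacter (G : Type) [Group G] (χ : G → ℂ) : Prop :=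
  ∃ V : FDRep ℂ G, V.character = χ

/-- `χ` is an irreducible complex character of `G`. -/
def IsIrrCharacter (G : Type) [Group G] (χ : G → ℂ) : Prop :=
  ∃ V : FDRep ℂ G, CategoryTheory.Simple V ∧ V.character = χ

/-- `⟨χ|_H, θ⟩ = (1/|H|) ∑_{h ∈ H} χ(h) θ(h)⁻¹`, the multiplicity of the linear
character `θ` of `H` in the restriction `χ|_H`. -/
def restMult {G : Type} [Group G] [Finite G] (H : Subgroup G) (θ : H →* ℂˣ) (χ : G → ℂ) : ℂ :=
  letI : Fintype H := Fintype.ofFinite H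
  (Nat.card H : ℂ)⁻¹ * ∑ h : H, χ h * ((θ h : ℂ))⁻¹

/-- `dim χ^H = (1/|H|) ∑_{h ∈ H} χ(h)`, the dimension of the `H`-fixed subspace. -/
def dimFixed {G : Type} [Group G] [Finite G] (H : Subgroup G) (χ : G → ℂ) : ℂ :=
  letI : Fintype H := Fintype.ofFinite H
  (Nat.card H : ℂ)⁻¹ * ∑ h : H, χ h

/-- The ramification multiplicity
`Γ(χ) = (1/2)⟨χ|_{H₂},θ₂⟩ + (1/3)(⟨χ|_{H₃},θ₃⟩ + 2⟨χ|_{H₃},θ₃²⟩)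
  + (1/7)∑_{k=1}^{6} k ⟨χ|_{H₇},θ₇^k⟩`. -/
def ramMult {G : Type} [Group G] [Finite G] (H2 H3 H7 : Subgroup G)
    (θ2 : H2 →* ℂˣ) (θ3 : H3 →* ℂˣ) (θ7 : H7 →* ℂˣ) (χ : G → ℂ) : ℂ :=
  (1/2) * restMult H2 θ2 χ
    + (1/3) * (restMult H3 θ3 χ + 2 * restMult H3 (θ3 ^ 2) χ)
    + (1/7) * ∑ k ∈ Finset.Icc (1:ℕ) 6, (k : ℂ) * restMult H7 (θ7 ^ k) χ

/-- The base multiplicity `m = (q−ε₂)/4 + (q−ε₃)/3 + 3(q−ε₇)/7`, where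
`ε_ℓ = 1` if `q ≡ 1 (mod ℓ')` and `ε_ℓ = −1` otherwise. -/
def baseMult (q : ℕ) : ℤ :=
  ((q : ℤ) - (if q % 4 = 1 then 1 else -1)) / 4
    + ((q : ℤ) - (if q % 3 = 1 then 1 else -1)) / 3
    + 3 * (((q : ℤ) - (if q % 7 = 1 then 1 else -1)) / 7)

end

namespace Module.End

variable {W : Type*} [AddCommGroup W] [Module ℂ W] [FiniteDimensional ℂ W]

theorem exists_eigenvalues_of_pow_eq_one (f : Module.End ℂ W) {n : ℕ} (hn : n ≠ 0)
    (hf : f ^ n = 1) :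
    ∃ r : Fin (Module.finrank ℂ W) → ℂ, (∀ i, r i ^ n = 1) ∧
      (∀ k : ℕ, LinearMap.trace ℂ W (f ^ k) = ∑ i, r i ^ k) ∧ LinearMap.det f = ∏ i, r i := by
  have hss : f.IsSemisimple := by
    refine isSemisimple_of_squarefree_aeval_eq_zero (p := Polynomial.X ^ n - Polynomial.C 1) ?_ ?_
    · exact (Polynomial.separable_X_pow_sub_C (1 : ℂ) (by exact_mod_cast hn) one_ne_zero).squarefree
    · simp [hf]
  have hspan : ⊤ ≤ Submodule.span ℂ {v : W | ∃ μ : ℂ, f v = μ • v} := by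
    rw [← hss.iSup_eigenspace_eq_top]
    refine iSup_le fun μ v hv => Submodule.subset_span ⟨μ, mem_eigenspace_iff.1 hv⟩
  let b := Module.Basis.ofSpan hspan
  let b' := b.reindex (Fintype.equivFinOfCardEq (Module.finrank_eq_card_basis b).symm)
  have hb : ∀ i, ∃ μ : ℂ, f (b' i) = μ • b' i := by
    intro i
    have := Module.Basis.ofSpan_subset hspan
    apply this
    simp only [b', Module.Basis.reindex_apply]
    exact ⟨_, rfl⟩
  choose r hr using hb
  have hpow : ∀ (k : ℕ) i, (f ^ k) (b' i) = r i ^ k • b' i := by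
    intro k
    induction k with
    | zero => simp
    | succ k ih =>
      intro i
      rw [pow_succ', Module.End.mul_apply, ih, map_smul, hr, smul_smul, ← pow_succ]
  have hmat : ∀ k : ℕ, LinearMap.toMatrix b' b' (f ^ k) = Matrix.diagonal (fun i => r i ^ k) := by
    intro k
    ext i j
    rw [LinearMap.toMatrix_apply, hpow, Matrix.diagonal_apply]
    by_cases h : i = j
    · simp [h]
    · simp [h]
  refine ⟨r, fun i => ?_, fun k => ?_, ?_⟩
  · have := hpow n i
    rw [hf, Module.End.one_apply] at this
    have h2 : (r i ^ n - 1) • b' i = 0 := by rw [sub_smul, ← this, one_smul, sub_self]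
    rcases smul_eq_zero.1 h2 with h | h
    · exact sub_eq_zero.1 h
    · exact absurd h (b'.ne_zero i)
  · rw [LinearMap.trace_eq_matrix_trace ℂ b', hmat, Matrix.trace_diagonal]
  · rw [← LinearMap.det_toMatrix b', ← pow_one f, hmat, Matrix.det_diagonal]
    simp

theorem eq_one_of_trace_eq_finrank {e : Module.End ℂ W} (he : IsIdempotentElem e)
    (h : LinearMap.trace ℂ W e = Module.finrank ℂ W) : e = 1 := by
  have h2 : LinearMap.trace ℂ W (1 - e) = 0 := by
    rw [map_sub, h, LinearMap.trace_one, sub_self]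
  have := LinearMap.IsIdempotentElem.eq_zero_of_trace_eq_zero he.one_sub h2
  exact (sub_eq_zero.1 this).symm

theorem exists_nat_trace_of_isIdempotentElem {e : Module.End ℂ W} (he : IsIdempotentElem e) :
    ∃ m : ℕ, LinearMap.trace ℂ W e = m :=
  ⟨_, (LinearMap.IsIdempotentElem.isProj_range e he).trace⟩

end Module.End

/-- The projection onto the `ψ (a * ·)`-isotypic part of a representation `σ` of the additive
group of a finite field. -/
noncomputable def isotypicProj {F W : Type*} [Field F] [Fintype F] [AddCommGroup W] [Module ℂ W]
    (ψ : AddChar F ℂ) (σ : F → Module.End ℂ W) (a : F) : Module.End ℂ W :=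
  (Fintype.card F : ℂ)⁻¹ • ∑ x, ψ (-(a * x)) • σ x

section isotypicProj

variable {F W : Type*} [Field F] [Fintype F] [AddCommGroup W] [Module ℂ W]
  {ψ : AddChar F ℂ} {σ : F → Module.End ℂ W}

theorem mul_isotypicProj (hadd : ∀ x y, σ (x + y) = σ x * σ y) (x a : F) :
    σ x * isotypicProj ψ σ a = ψ (a * x) • isotypicProj ψ σ a := by
  unfold isotypicProj
  rw [mul_smul_comm, smul_comm (ψ (a * x))]
  congr 1
  rw [Finset.mul_sum, Finset.smul_sum]
  refine Fintype.sum_equiv (Equiv.addLeft x) (fun y => σ x * ψ (-(a * y)) • σ y)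
    (fun y => ψ (a * x) • ψ (-(a * y)) • σ y) fun y => ?_
  simp only [Equiv.coe_addLeft]
  rw [mul_smul_comm, ← hadd, smul_smul, ← AddChar.map_add_eq_mul]
  congr 2
  ring

theorem isotypicProj_mul_isotypicProj (hψ : ψ.IsPrimitive) (hadd : ∀ x y, σ (x + y) = σ x * σ y)
    (b a : F) :
    isotypicProj ψ σ b * isotypicProj ψ σ a = if b = a then isotypicProj ψ σ a else 0 := by
  have h : isotypicProj ψ σ b * isotypicProj ψ σ a =
      ((Fintype.card F : ℂ)⁻¹ * ∑ x, ψ (x * (a - b))) • isotypicProj ψ σ a := by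
    conv_lhs => rw [isotypicProj]
    rw [smul_mul_assoc, Finset.sum_mul, mul_smul, Finset.sum_smul]
    congr 1
    refine Finset.sum_congr rfl fun x _ => ?_
    rw [smul_mul_assoc, mul_isotypicProj hadd, smul_smul, ← AddChar.map_add_eq_mul]
    congr 2
    ring
  rw [h, AddChar.sum_mulShift _ hψ]
  by_cases hab : b = a
  · simp [hab]
  · simp [hab, sub_eq_zero, Ne.symm hab]

theorem sum_isotypicProj (hψ : ψ.IsPrimitive) (h0 : σ 0 = 1) :
    ∑ a, isotypicProj ψ σ a = 1 := by
  unfold isotypicProj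
  rw [← Finset.smul_sum, Finset.sum_comm]
  simp_rw [← Finset.sum_smul]
  have : ∀ x : F, ∑ a, ψ (-(a * x)) = if x = 0 then (Fintype.card F : ℂ) else 0 := by
    intro x
    have := AddChar.sum_mulShift (-x) hψ
    simpa using this
  simp_rw [this]
  simp [h0]

theorem apply_eq_sum_isotypicProj (hψ : ψ.IsPrimitive) (h0 : σ 0 = 1)
    (hadd : ∀ x y, σ (x + y) = σ x * σ y) (x : F) :
    σ x = ∑ a, ψ (a * x) • isotypicProj ψ σ a := by
  simp_rw [← mul_isotypicProj hadd, ← Finset.mul_sum, sum_isotypicProj hψ h0, mul_one]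

theorem sum_trace_mul_trace_neg (hψ : ψ.IsPrimitive) (h0 : σ 0 = 1)
    (hadd : ∀ x y, σ (x + y) = σ x * σ y) :
    ∑ x, LinearMap.trace ℂ W (σ x) * LinearMap.trace ℂ W (σ (-x)) =
      Fintype.card F * ∑ a, LinearMap.trace ℂ W (isotypicProj ψ σ a) ^ 2 := by
  set m : F → ℂ := fun a => LinearMap.trace ℂ W (isotypicProj ψ σ a) with hm
  have ht : ∀ x, LinearMap.trace ℂ W (σ x) = ∑ a, ψ (a * x) * m a := by
    intro x
    rw [apply_eq_sum_isotypicProj hψ h0 hadd x, map_sum]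
    simp [hm]
  have : ∀ x, LinearMap.trace ℂ W (σ x) * LinearMap.trace ℂ W (σ (-x)) =
      ∑ a, ∑ b, ψ (x * (a - b)) * (m a * m b) := by
    intro x
    rw [ht, ht, Finset.sum_mul_sum]
    refine Finset.sum_congr rfl fun a _ => Finset.sum_congr rfl fun b _ => ?_
    rw [show x * (a - b) = a * x + b * -x by ring, AddChar.map_add_eq_mul]
    ring
  simp_rw [this]
  rw [Finset.sum_comm, Finset.mul_sum]
  refine Finset.sum_congr rfl fun a _ => ?_
  rw [Finset.sum_comm]
  simp_rw [← Finset.sum_mul, AddChar.sum_mulShift _ hψ]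
  simp [sub_eq_zero, sq, hm]

theorem conj_isotypicProj {τ τ' : Module.End ℂ W} {s : F} (hs : s ≠ 0)
    (h : ∀ x, τ * σ x = σ (s * x) * τ') (a : F) :
    τ * isotypicProj ψ σ (s * a) = isotypicProj ψ σ a * τ' := by
  unfold isotypicProj
  rw [mul_smul_comm, smul_mul_assoc, Finset.mul_sum, Finset.sum_mul]
  congr 1
  refine Fintype.sum_equiv (Equiv.mulLeft₀ s hs) _ _ fun y => ?_
  change _ = ψ (-(a * (s * y))) • σ (s * y) * τ'
  rw [mul_smul_comm, h, smul_mul_assoc]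
  congr 3
  ring

end isotypicProj

open Matrix Matrix.SpecialLinearGroup in
/-- A representation of `SL(2, F)`, trivial on `-1` and satisfying the norm relation of an
irreducible character, of degree `(q - 1) / 2` where `q = |F|` is `3` modulo `4`. -/
structure IsHalfDiscrete {F W : Type*} [Field F] [Fintype F] [AddCommGroup W] [Module ℂ W]
    (ρ : Matrix.SpecialLinearGroup (Fin 2) F →* Module.End ℂ W) : Prop where
  map_neg_one : ρ (-1) = 1
  two_mul_finrank : 2 * Module.finrank ℂ W + 1 = Fintype.card F
  sum_trace : ∑ A, LinearMap.trace ℂ W (ρ A) * LinearMap.trace ℂ W (ρ A⁻¹) =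
    Fintype.card (Matrix.SpecialLinearGroup (Fin 2) F)
  card_mod_four : Fintype.card F % 4 = 3
  three_lt_card : 3 < Fintype.card F

namespace IsHalfDiscrete

open Matrix Matrix.SpecialLinearGroup

section

variable {F W : Type*} [Field F] [AddCommGroup W] [Module ℂ W]
  {ρ : Matrix.SpecialLinearGroup (Fin 2) F →* Module.End ℂ W}

/-- The action of the unipotent upper triangular matrices. -/
noncomputable def unipotent (ρ : Matrix.SpecialLinearGroup (Fin 2) F →* Module.End ℂ W) (x : F) :
    Module.End ℂ W :=
  ρ (transvection (zero_ne_one (α := Fin 2)) x)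

theorem unipotent_zero : unipotent ρ 0 = 1 := by
  simp [unipotent]

theorem unipotent_add (x y : F) : unipotent ρ (x + y) = unipotent ρ x * unipotent ρ y := by
  rw [unipotent, unipotent, unipotent, ← map_mul]
  congr 1
  ext i j
  fin_cases i <;> fin_cases j <;>
    simp [transvection_coe, Matrix.mul_apply, Fin.sum_univ_two, add_comm]

theorem diag2_mul_unipotent {s : F} (hs : s ≠ 0) (x : F) :
    ρ (diag2 s hs) * unipotent ρ x = unipotent ρ (s ^ 2 * x) * ρ (diag2 s hs) := by
  rw [unipotent, unipotent, ← map_mul, ← map_mul]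
  congr 1
  ext i j
  fin_cases i <;> fin_cases j <;>
    simp [transvection_coe, diag2_coe', Matrix.mul_apply, Fin.sum_univ_two]
  field_simp

theorem trace_isotypicProj_sq_mul [Fintype F] {ψ : AddChar F ℂ} {s : F} (hs : s ≠ 0) (a : F) :
    LinearMap.trace ℂ W (isotypicProj ψ (unipotent ρ) (s ^ 2 * a)) =
      LinearMap.trace ℂ W (isotypicProj ψ (unipotent ρ) a) := by
  have h := conj_isotypicProj (ψ := ψ) (pow_ne_zero 2 hs) (diag2_mul_unipotent (ρ := ρ) hs) a
  have hinv : ρ (diag2 s hs) * ρ (diag2 s hs)⁻¹ = 1 := by rw [← map_mul, mul_inv_cancel, map_one]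
  have hinv' : ρ (diag2 s hs)⁻¹ * ρ (diag2 s hs) = 1 := by rw [← map_mul, inv_mul_cancel, map_one]
  calc _ = LinearMap.trace ℂ W (ρ (diag2 s hs)⁻¹ *
        (ρ (diag2 s hs) * isotypicProj ψ (unipotent ρ) (s ^ 2 * a))) := by
        rw [← mul_assoc, hinv', one_mul]
    _ = _ := by rw [h, LinearMap.trace_mul_comm, mul_assoc, hinv, mul_one]

end

variable {F W : Type*} [Field F] [Fintype F] [AddCommGroup W] [Module ℂ W]
  {ρ : Matrix.SpecialLinearGroup (Fin 2) F →* Module.End ℂ W} {ψ : AddChar F ℂ}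

theorem one_lt_finrank (h : IsHalfDiscrete ρ) : 1 < Module.finrank ℂ W := by
  have := h.two_mul_finrank
  have := h.three_lt_card
  omega

theorem finiteDimensional (h : IsHalfDiscrete ρ) : FiniteDimensional ℂ W :=
  Module.finite_of_finrank_pos (by have := h.one_lt_finrank; omega)

theorem not_isSquare_neg_one (h : IsHalfDiscrete ρ) : ¬ IsSquare (-1 : F) := by
  rw [FiniteField.isSquare_neg_one_iff]
  simp [h.card_mod_four]

theorem exists_sq_or_neg_sq (h : IsHalfDiscrete ρ) (a : F) : ∃ s, a = s ^ 2 ∨ a = -s ^ 2 := by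
  by_cases ha : IsSquare a
  · obtain ⟨s, hs⟩ := ha
    exact ⟨s, Or.inl (by rw [hs, sq])⟩
  · have h2 : IsSquare (-a) := by
      have := quadraticChar_neg_one_iff_not_isSquare.2 ha
      have h1 := quadraticChar_neg_one_iff_not_isSquare.2 h.not_isSquare_neg_one
      have ha0 : a ≠ 0 := by rintro rfl; exact ha (IsSquare.zero)
      rw [← quadraticChar_one_iff_isSquare (neg_ne_zero.2 ha0), neg_eq_neg_one_mul, map_mul,
        this, h1]
      norm_num
    obtain ⟨s, hs⟩ := h2
    exact ⟨s, Or.inr (by rw [eq_neg_iff_add_eq_zero, sq, ← hs]; ring)⟩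

theorem not_forall_transvection (h : IsHalfDiscrete ρ) :
    ¬ ∀ x : F, ρ (transvection (zero_ne_one (α := Fin 2)) x) = 1 := by
  have := h.finiteDimensional
  intro hu
  have hall : ∀ A, ρ A = 1 := by
    intro A
    induction A using SL2.transvection_induction with
    | htransvec i j hij c =>
      have hcase : (i = 0 ∧ j = 1) ∨ (i = 1 ∧ j = 0) := by
        fin_cases i <;> fin_cases j <;> simp_all
      rcases hcase with ⟨rfl, rfl⟩ | ⟨rfl, rfl⟩
      · exact hu c
      · obtain ⟨w, hw⟩ : ∃ w : Matrix.SpecialLinearGroup (Fin 2) F, w.1 = !![0, -1; 1, 0] :=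
          ⟨⟨!![0, -1; 1, 0], by simp [det_fin_two]⟩, rfl⟩
        have : transvection hij c * w = w * transvection (zero_ne_one (α := Fin 2)) (-c) := by
          ext i j
          fin_cases i <;> fin_cases j <;>
            simp [hw, transvection_coe, Matrix.mul_apply, Fin.sum_univ_two]
        have h1 := congrArg ρ this
        rw [map_mul, map_mul, hu, mul_one] at h1
        have h2 : ρ w * ρ w⁻¹ = 1 := by rw [← map_mul, mul_inv_cancel, map_one]
        rw [← mul_one (ρ (transvection hij c)), ← h2, ← mul_assoc, h1, h2]
    | hmul A B hA hB => rw [map_mul, hA, hB, one_mul]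
  have := h.sum_trace
  simp only [hall, LinearMap.trace_one, Finset.sum_const, Finset.card_univ, nsmul_eq_mul] at this
  have h3 : Module.finrank ℂ W * Module.finrank ℂ W = 1 := by
    have hc : (Fintype.card (Matrix.SpecialLinearGroup (Fin 2) F) : ℂ) ≠ 0 := by
      exact_mod_cast Fintype.card_ne_zero
    have := mul_left_cancel₀ hc (this.trans (mul_one _).symm)
    exact_mod_cast this
  have := h.one_lt_finrank
  nlinarith

theorem isotypic_multiplicities (h : IsHalfDiscrete ρ) (hψ : ψ.IsPrimitive) :
    isotypicProj ψ (unipotent ρ) 0 = 0 ∧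
      ∀ a, LinearMap.trace ℂ W (isotypicProj ψ (unipotent ρ) a) ^ 2 =
        LinearMap.trace ℂ W (isotypicProj ψ (unipotent ρ) a) := by
  have := h.finiteDimensional
  have hidem : ∀ a, IsIdempotentElem (isotypicProj ψ (unipotent ρ) a) := fun a => by
    rw [IsIdempotentElem, isotypicProj_mul_isotypicProj hψ unipotent_add, if_pos rfl]
  choose m hm using fun a => Module.End.exists_nat_trace_of_isIdempotentElem (hidem a)
  have hsum : ∑ a, m a = Module.finrank ℂ W := by
    have := congrArg (LinearMap.trace ℂ W) (sum_isotypicProj hψ (unipotent_zero (ρ := ρ)))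
    rw [map_sum, LinearMap.trace_one] at this
    simp_rw [hm] at this
    exact_mod_cast this
  have hsq : ∀ s a, s ≠ 0 → m (s ^ 2 * a) = m a := fun s a hs => by
    have := trace_isotypicProj_sq_mul (ρ := ρ) (ψ := ψ) hs a
    rw [hm, hm] at this
    exact_mod_cast this
  have hpair : ∀ a, a ≠ 0 → m a + m (-a) = m 1 + m (-1) := fun a ha => by
    obtain ⟨s, hs | hs⟩ := h.exists_sq_or_neg_sq a
    · have hs0 : s ≠ 0 := by rintro rfl; simp [hs] at ha
      have h1 := hsq s 1 hs0
      have h2 := hsq s (-1) hs0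
      rw [hs, ← h1, ← h2]; simp
    · have hs0 : s ≠ 0 := by rintro rfl; simp [hs] at ha
      have h1 := hsq s 1 hs0
      have h2 := hsq s (-1) hs0
      rw [hs, ← h1, ← h2]; simp [add_comm]
  have hcount : m 0 + Module.finrank ℂ W * (m 1 + m (-1)) = Module.finrank ℂ W := by
    have hneg : ∑ a ∈ Finset.univ.erase (0 : F), m (-a) = ∑ a ∈ Finset.univ.erase (0 : F), m a :=
      Finset.sum_nbij' (fun a => -a) (fun a => -a) (by simp) (by simp) (by simp) (by simp) (by simp)
    have h2 : ∑ a ∈ Finset.univ.erase (0 : F), (m a + m (-a)) =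
        (Fintype.card F - 1) * (m 1 + m (-1)) := by
      rw [Finset.sum_congr rfl (fun a ha => hpair a (Finset.ne_of_mem_erase ha)),
        Finset.sum_const, Finset.card_erase_of_mem (Finset.mem_univ _), Finset.card_univ,
        smul_eq_mul]
    rw [Finset.sum_add_distrib, hneg, ← h.two_mul_finrank, Nat.add_sub_cancel] at h2
    have h3 := Finset.add_sum_erase Finset.univ m (Finset.mem_univ (0 : F))
    rw [hsum] at h3
    linarith
  have hpos := h.one_lt_finrank
  have hne : m 1 + m (-1) ≠ 0 := by
    intro h0
    rw [h0, mul_zero, add_zero] at hcount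
    apply h.not_forall_transvection
    intro x
    have h1 := Module.End.eq_one_of_trace_eq_finrank (hidem 0) (by rw [hm, hcount])
    have h2 := mul_isotypicProj (ψ := ψ) (unipotent_add (ρ := ρ)) x 0
    rw [h1] at h2
    simpa [unipotent] using h2
  have h1 : m 1 + m (-1) = 1 := by
    by_contra hne1
    have : 2 ≤ m 1 + m (-1) := by omega
    nlinarith
  have h0 : m 0 = 0 := by rw [h1] at hcount; omega
  refine ⟨LinearMap.IsIdempotentElem.eq_zero_of_trace_eq_zero (hidem 0) (by rw [hm, h0]; simp), ?_⟩
  intro a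
  rw [hm]
  have : m a = 0 ∨ m a = 1 := by
    by_cases ha : a = 0
    · left; rw [ha, h0]
    · have := hpair a ha
      omega
  rcases this with h | h <;> simp [h]

theorem sum_unipotent (h : IsHalfDiscrete ρ) :
    ∑ x, LinearMap.trace ℂ W (unipotent ρ x) * LinearMap.trace ℂ W (unipotent ρ (-x)) =
      Fintype.card F * Module.finrank ℂ W := by
  have := h.finiteDimensional
  have hψ := AddChar.FiniteField.primitiveChar_to_Complex_isPrimitive F
  rw [sum_trace_mul_trace_neg hψ unipotent_zero unipotent_add]
  simp_rw [(h.isotypic_multiplicities hψ).2]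
  rw [← map_sum, sum_isotypicProj hψ unipotent_zero, LinearMap.trace_one]

theorem trace_diag2 (h : IsHalfDiscrete ρ) {s : F} (hs : s ≠ 0) (hs2 : s ^ 2 ≠ 1) :
    LinearMap.trace ℂ W (ρ (diag2 s hs)) = 0 := by
  obtain ⟨ψ, hψ⟩ : ∃ ψ : AddChar F ℂ, ψ.IsPrimitive :=
    ⟨_, AddChar.FiniteField.primitiveChar_to_Complex_isPrimitive F⟩
  obtain ⟨e, he⟩ : ∃ e, e = isotypicProj ψ (unipotent ρ) := ⟨_, rfl⟩
  have hee := isotypicProj_mul_isotypicProj hψ (unipotent_add (ρ := ρ))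
  have hterm : ∀ a, LinearMap.trace ℂ W (ρ (diag2 s hs) * e (s ^ 2 * a)) = 0 := by
    intro a
    by_cases ha : a = 0
    · rw [ha, mul_zero, he, (h.isotypic_multiplicities hψ).1, mul_zero, map_zero]
    · have h1 : e (s ^ 2 * a) = e (s ^ 2 * a) * e (s ^ 2 * a) := by rw [he, hee, if_pos rfl]
      rw [h1, ← mul_assoc, he, conj_isotypicProj (pow_ne_zero 2 hs) (diag2_mul_unipotent hs) a,
        LinearMap.trace_mul_comm, ← mul_assoc, hee, if_neg, zero_mul, map_zero]
      intro heq
      exact hs2 (mul_right_cancel₀ ha (heq.trans (one_mul a).symm))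
  calc _ = LinearMap.trace ℂ W (ρ (diag2 s hs) * ∑ a, e a) := by
        rw [he, sum_isotypicProj hψ unipotent_zero, mul_one]
    _ = ∑ a, LinearMap.trace ℂ W (ρ (diag2 s hs) * e a) := by rw [Finset.mul_sum, map_sum]
    _ = ∑ a, LinearMap.trace ℂ W (ρ (diag2 s hs) * e (s ^ 2 * a)) :=
        (Equiv.sum_comp (Equiv.mulLeft₀ (s ^ 2) (pow_ne_zero 2 hs))
          fun a => LinearMap.trace ℂ W (ρ (diag2 s hs) * e a)).symm
    _ = 0 := Finset.sum_eq_zero fun a _ => hterm a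

end IsHalfDiscrete

namespace Matrix.SpecialLinearGroup

open Matrix

variable {F : Type*} [Field F]

theorem smul_eq_fin_two (A : SpecialLinearGroup (Fin 2) F) (v : Fin 2 → F) :
    A • v = ![A 0 0 * v 0 + A 0 1 * v 1, A 1 0 * v 0 + A 1 1 * v 1] := by
  rw [SpecialLinearGroup.smul_def, Matrix.smul_eq_mulVec]
  ext i
  fin_cases i <;> simp [mulVec, dotProduct, Fin.sum_univ_two]

theorem exists_smul_eq_of_ne_zero {v : Fin 2 → F} (hv : v ≠ 0) :
    ∃ g : SpecialLinearGroup (Fin 2) F, g • ![1, 0] = v := by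
  have hc : IsCoprime (v 0) (v 1) := by
    by_cases h0 : v 0 = 0
    · have h1 : v 1 ≠ 0 := fun h1 => hv (by ext i; fin_cases i <;> simp [h0, h1])
      exact ⟨0, (v 1)⁻¹, by field_simp; ring⟩
    · exact ⟨(v 0)⁻¹, 0, by field_simp; ring⟩
  obtain ⟨g, h0, h1⟩ := hc.exists_SL2_col 0
  refine ⟨g, ?_⟩
  rw [smul_eq_fin_two]
  ext i
  fin_cases i <;> simp [h0, h1]

theorem smul_fst_eq_iff (A : SpecialLinearGroup (Fin 2) F) :
    A • (![1, 0] : Fin 2 → F) = ![1, 0] ↔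
      ∃ x, transvection (zero_ne_one (α := Fin 2)) x = A := by
  constructor
  · intro h
    rw [smul_eq_fin_two] at h
    have h0 := congrFun h 0
    have h1 := congrFun h 1
    simp at h0 h1
    have hdet := A.det_coe
    rw [det_fin_two, h0, h1] at hdet
    refine ⟨A 0 1, ?_⟩
    ext i j
    fin_cases i <;> fin_cases j <;> simp [transvection_coe, h0, h1]
    simpa using hdet.symm
  · rintro ⟨x, rfl⟩
    rw [smul_eq_fin_two]
    ext i
    fin_cases i <;> simp [transvection_coe]

theorem transvection_zero_one_injective :
    Function.Injective (transvection (F := F) (zero_ne_one (α := Fin 2))) := by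
  intro x y h
  have := congrArg (fun A => A.1 0 1) h
  simpa [transvection_coe] using this

theorem exists_conj_transvection_of_smul_eq {A : SpecialLinearGroup (Fin 2) F} {v : Fin 2 → F}
    (hv : v ≠ 0) (h : A • v = v) :
    ∃ g x, A = g * transvection (zero_ne_one (α := Fin 2)) x * g⁻¹ := by
  obtain ⟨g, rfl⟩ := exists_smul_eq_of_ne_zero hv
  have : (g⁻¹ * A * g) • (![1, 0] : Fin 2 → F) = ![1, 0] := by
    rw [mul_smul, mul_smul, h, inv_smul_smul]
  obtain ⟨x, hx⟩ := (smul_fst_eq_iff _).1 this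
  exact ⟨g, x, by rw [hx]; group⟩

theorem trace_conj (A g : SpecialLinearGroup (Fin 2) F) :
    (g * A * g⁻¹).1.trace = A.1.trace := by
  rw [coe_mul, Matrix.trace_mul_comm, ← coe_mul, ← mul_assoc, inv_mul_cancel, one_mul]

theorem trace_transvection (x : F) :
    (transvection (zero_ne_one (α := Fin 2)) x).1.trace = 2 := by
  simp [transvection_coe]

theorem exists_eigenvector {A : SpecialLinearGroup (Fin 2) F} {s : F}
    (hs : s * s - A.1.trace * s + 1 = 0) : ∃ v : Fin 2 → F, v ≠ 0 ∧ A • v = s • v := by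
  have hdet := A.det_coe
  rw [det_fin_two] at hdet
  rw [trace_fin_two] at hs
  by_cases h1 : A 0 1 = 0 ∧ s = A 0 0
  · by_cases h2 : A 1 0 = 0 ∧ s = A 1 1
    · refine ⟨![1, 0], by simp, ?_⟩
      rw [smul_eq_fin_two]
      ext i
      fin_cases i <;> simp [h1, h2]
    · refine ⟨![s - A 1 1, A 1 0], ?_, ?_⟩
      · intro h
        have h3 := congrFun h 0
        have h4 := congrFun h 1
        simp at h3 h4
        exact h2 ⟨h4, sub_eq_zero.1 h3⟩
      · rw [smul_eq_fin_two]
        ext i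
        fin_cases i <;> simp
        · linear_combination -hs - hdet
        · ring
  · refine ⟨![A 0 1, s - A 0 0], ?_, ?_⟩
    · intro h
      have h3 := congrFun h 0
      have h4 := congrFun h 1
      simp at h3 h4
      exact h1 ⟨h3, sub_eq_zero.1 h4⟩
    · rw [smul_eq_fin_two]
      ext i
      fin_cases i <;> simp
      · ring
      · linear_combination -hs - hdet

theorem exists_conj_diag2 {A : SpecialLinearGroup (Fin 2) F} {s : F}
    (hs : s * s - A.1.trace * s + 1 = 0) (hs0 : s ≠ 0) (hs2 : s ^ 2 ≠ 1) :
    ∃ g, A = g * diag2 s hs0 * g⁻¹ := by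
  obtain ⟨v, hv, hAv⟩ := exists_eigenvector hs
  obtain ⟨g, rfl⟩ := exists_smul_eq_of_ne_zero hv
  obtain ⟨B, hB⟩ : ∃ B, B = g⁻¹ * A * g := ⟨_, rfl⟩
  have hBv : B • (![1, 0] : Fin 2 → F) = s • ![1, 0] := by
    rw [hB, mul_smul, mul_smul, hAv, smul_comm, inv_smul_smul]
  rw [smul_eq_fin_two] at hBv
  have h0 := congrFun hBv 0
  have h1 := congrFun hBv 1
  simp at h0 h1
  have hdet := B.det_coe
  rw [det_fin_two, h0, h1] at hdet
  have h11 : B 1 1 = s⁻¹ := by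
    exact eq_inv_of_mul_eq_one_right (by linear_combination hdet)
  have hss : s⁻¹ - s ≠ 0 := by
    intro h
    apply hs2
    field_simp at h
    linear_combination -h
  obtain ⟨y, hy⟩ : ∃ y, y = B 0 1 / (s⁻¹ - s) := ⟨_, rfl⟩
  have hy' : B 0 1 = y * (s⁻¹ - s) := by rw [hy]; field_simp
  have hconj : B * transvection (zero_ne_one (α := Fin 2)) y =
      transvection (zero_ne_one (α := Fin 2)) y * diag2 s hs0 := by
    ext i j
    fin_cases i <;> fin_cases j <;>
      simp [transvection_coe, diag2_coe', Matrix.mul_apply, Fin.sum_univ_two, h0, h1, h11, hy']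
    ring
  refine ⟨g * transvection (zero_ne_one (α := Fin 2)) y, ?_⟩
  have : B = transvection (zero_ne_one (α := Fin 2)) y * diag2 s hs0 *
      (transvection (zero_ne_one (α := Fin 2)) y)⁻¹ := by rw [← hconj]; group
  have h2 : A = g * B * g⁻¹ := by rw [hB]; group
  rw [h2, this]
  group

/-- A matrix of determinant one with split discriminant is conjugate to a diagonal one. -/
theorem exists_conj_diag2_of_isSquare (h2 : (2 : F) ≠ 0) {A : SpecialLinearGroup (Fin 2) F}
    (hsq : IsSquare (A.1.trace ^ 2 - 4)) (ht : A.1.trace ≠ 2) (ht' : A.1.trace ≠ -2) :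
    ∃ (g : SpecialLinearGroup (Fin 2) F) (s : F) (hs0 : s ≠ 0),
      s ^ 2 ≠ 1 ∧ A = g * diag2 s hs0 * g⁻¹ := by
  obtain ⟨y, hy⟩ := hsq
  obtain ⟨s, hs⟩ : ∃ s, s = (A.1.trace + y) / 2 := ⟨_, rfl⟩
  have hroot : s * s - A.1.trace * s + 1 = 0 := by
    rw [hs]
    field_simp
    linear_combination -hy
  have hs0 : s ≠ 0 := by rintro rfl; simp at hroot
  have hs2 : s ^ 2 ≠ 1 := by
    intro h
    have h3 : s = 1 ∨ s = -1 := sq_eq_one_iff.1 h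
    rcases h3 with rfl | rfl
    · apply ht; linear_combination -hroot
    · apply ht'; linear_combination hroot
  obtain ⟨g, hg⟩ := exists_conj_diag2 hroot hs0 hs2
  exact ⟨g, s, hs0, hs2, hg⟩

variable [Fintype F]

theorem sum_stabilizer (f : SpecialLinearGroup (Fin 2) F → ℂ)
    (hf : ∀ A g, f (g * A * g⁻¹) = f A) {v : Fin 2 → F} (hv : v ≠ 0) :
    ∑ A, (if A • v = v then f A else 0) = ∑ x, f (transvection (zero_ne_one (α := Fin 2)) x) := by
  obtain ⟨g, rfl⟩ := exists_smul_eq_of_ne_zero hv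
  have h1 : ∑ A : SpecialLinearGroup (Fin 2) F,
        (if A • g • (![1, 0] : Fin 2 → F) = g • ![1, 0] then f A else 0) =
      ∑ A : SpecialLinearGroup (Fin 2) F,
        (if A • (![1, 0] : Fin 2 → F) = ![1, 0] then f A else 0) := by
    refine (Fintype.sum_equiv (MulAut.conj g).toEquiv _ _ fun A => ?_).symm
    simp only [MulEquiv.toEquiv_eq_coe, MulEquiv.coe_toEquiv, MulAut.conj_apply, hf]
    congr 1
    rw [mul_smul, mul_smul, inv_smul_smul, smul_left_cancel_iff]
  rw [h1, ← Finset.sum_filter]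
  symm
  refine Finset.sum_bij (fun x _ => transvection (zero_ne_one (α := Fin 2)) x) ?_ ?_ ?_ ?_
  · intro x _
    simpa using (smul_fst_eq_iff _).2 ⟨x, rfl⟩
  · intro x _ y _ h
    exact transvection_zero_one_injective h
  · intro A hA
    obtain ⟨x, hx⟩ := (smul_fst_eq_iff A).1 (by simpa using hA)
    exact ⟨x, Finset.mem_univ _, hx⟩
  · simp

theorem card_ne_zero_vectors :
    (Finset.univ.filter fun v : Fin 2 → F => v ≠ 0).card = Fintype.card F ^ 2 - 1 := by
  rw [Finset.filter_ne', Finset.card_erase_of_mem (Finset.mem_univ _), Finset.card_univ]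
  simp

theorem card_fixed_of_trace_eq_two {A : SpecialLinearGroup (Fin 2) F} (hA : A ≠ 1)
    (ht : A.1.trace = 2) :
    (Finset.univ.filter fun v : Fin 2 → F => v ≠ 0 ∧ A • v = v).card = Fintype.card F - 1 := by
  obtain ⟨v, hv, hAv⟩ := exists_eigenvector (A := A) (s := 1) (by rw [ht]; ring)
  rw [one_smul] at hAv
  obtain ⟨g, x, rfl⟩ := exists_conj_transvection_of_smul_eq hv hAv
  have hx : x ≠ 0 := by rintro rfl; simp at hA
  rw [← Finset.card_univ (α := F), ← Finset.card_erase_of_mem (Finset.mem_univ (0 : F))]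
  symm
  refine Finset.card_bij (fun c _ => g • ![c, 0]) ?_ ?_ ?_
  · intro c hc
    have hc0 : c ≠ 0 := by simpa using hc
    rw [Finset.mem_filter]
    refine ⟨Finset.mem_univ _, ?_, ?_⟩
    · rw [Ne, smul_eq_zero_iff_eq]
      intro h
      exact hc0 (congrFun h 0)
    · rw [mul_smul, mul_smul, inv_smul_smul, smul_left_cancel_iff, smul_eq_fin_two]
      ext i
      fin_cases i <;> simp [transvection_coe]
  · intro c _ c' _ h
    exact congrFun (smul_left_cancel g h) 0
  · intro w hw
    rw [Finset.mem_filter] at hw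
    obtain ⟨-, hw0, hw⟩ := hw
    obtain ⟨w', rfl⟩ : ∃ w', w = g • w' := ⟨g⁻¹ • w, by rw [smul_inv_smul]⟩
    rw [mul_smul, mul_smul, inv_smul_smul, smul_left_cancel_iff, smul_eq_fin_two] at hw
    have h0 := congrFun hw 0
    simp [transvection_coe, hx] at h0
    have hw' : w' = ![w' 0, 0] := by
      ext i
      fin_cases i <;> simp [h0]
    refine ⟨w' 0, ?_, by rw [← hw']⟩
    rw [Finset.mem_erase]
    refine ⟨fun h => hw0 ?_, Finset.mem_univ _⟩
    rw [hw', h]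
    rw [smul_eq_zero_iff_eq]
    ext i
    fin_cases i <;> simp

theorem sum_trace_eq_two (f : SpecialLinearGroup (Fin 2) F → ℂ)
    (hf : ∀ A g, f (g * A * g⁻¹) = f A) :
    ∑ A with A.1.trace = 2, f A = f 1 + (Fintype.card F + 1) *
      (∑ x, f (transvection (zero_ne_one (α := Fin 2)) x) - f 1) := by
  have hq : 1 < Fintype.card F := Fintype.one_lt_card
  have hlhs : ∑ v : Fin 2 → F with v ≠ 0, ∑ A, (if A • v = v then f A else 0) =
      ((Fintype.card F : ℂ) ^ 2 - 1) * ∑ x, f (transvection (zero_ne_one (α := Fin 2)) x) := by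
    rw [Finset.sum_congr rfl fun v hv => sum_stabilizer f hf (Finset.mem_filter.1 hv).2,
      Finset.sum_const, card_ne_zero_vectors, nsmul_eq_mul,
      Nat.cast_sub (Nat.one_le_pow _ _ (by omega))]
    simp
  have hrhs : ∑ v : Fin 2 → F with v ≠ 0, ∑ A, (if A • v = v then f A else 0) =
      ∑ A, ((Finset.univ.filter fun v : Fin 2 → F => v ≠ 0 ∧ A • v = v).card : ℂ) * f A := by
    rw [Finset.sum_comm]
    refine Finset.sum_congr rfl fun A _ => ?_
    rw [← Finset.sum_filter, Finset.filter_filter, Finset.sum_const, nsmul_eq_mul]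
  have hval : ∀ A : SpecialLinearGroup (Fin 2) F,
      ((Finset.univ.filter fun v : Fin 2 → F => v ≠ 0 ∧ A • v = v).card : ℂ) * f A =
        ((Fintype.card F : ℂ) - 1) * (if A.1.trace = 2 then f A else 0) +
          (if A = 1 then ((Fintype.card F : ℂ) ^ 2 - Fintype.card F) * f A else 0) := by
    intro A
    by_cases hA : A = 1
    · subst hA
      have htr : (1 : SpecialLinearGroup (Fin 2) F).1.trace = 2 := by
        simp
      simp only [one_smul, and_true, card_ne_zero_vectors, htr, if_true]
      rw [Nat.cast_sub (Nat.one_le_pow _ _ (by omega))]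
      push_cast
      ring
    · by_cases ht : A.1.trace = 2
      · rw [card_fixed_of_trace_eq_two hA ht, if_pos ht, if_neg hA, Nat.cast_sub hq.le]
        simp
      · rw [if_neg ht, if_neg hA, Finset.card_eq_zero.2]
        · simp
        · rw [Finset.filter_eq_empty_iff]
          rintro v - ⟨hv, hAv⟩
          obtain ⟨g, x, rfl⟩ := exists_conj_transvection_of_smul_eq hv hAv
          exact ht (by rw [trace_conj, trace_transvection])
  rw [hlhs] at hrhs
  simp_rw [hval] at hrhs
  rw [Finset.sum_add_distrib, ← Finset.mul_sum, ← Finset.sum_filter,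
    Finset.sum_ite_eq' Finset.univ (1 : SpecialLinearGroup (Fin 2) F),
    if_pos (Finset.mem_univ _)] at hrhs
  have hq1 : (Fintype.card F : ℂ) - 1 ≠ 0 := by
    rw [sub_ne_zero]
    exact_mod_cast hq.ne'
  apply mul_left_cancel₀ hq1
  linear_combination -hrhs

end Matrix.SpecialLinearGroup

namespace Matrix.SpecialLinearGroup

open Matrix

variable {F : Type*} [Field F] [Fintype F]

theorem card_fin_two_field :
    Fintype.card (SpecialLinearGroup (Fin 2) F) = Fintype.card F * (Fintype.card F ^ 2 - 1) := by
  have hfib : ∀ v : Fin 2 → F, v ≠ 0 →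
      (Finset.univ.filter fun A : SpecialLinearGroup (Fin 2) F =>
        A • (![1, 0] : Fin 2 → F) = v).card = Fintype.card F := by
    intro v hv
    obtain ⟨g, rfl⟩ := exists_smul_eq_of_ne_zero hv
    rw [← Finset.card_univ (α := F)]
    symm
    refine Finset.card_bij (fun x _ => g * transvection (zero_ne_one (α := Fin 2)) x) ?_ ?_ ?_
    · intro x _
      simpa [mul_smul] using (smul_fst_eq_iff _).2 ⟨x, rfl⟩
    · intro x _ y _ h
      exact transvection_zero_one_injective (mul_left_cancel h)
    · intro A hA
      obtain ⟨x, hx⟩ := (smul_fst_eq_iff (g⁻¹ * A)).1 (by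
        rw [mul_smul, (Finset.mem_filter.1 hA).2, inv_smul_smul])
      exact ⟨x, Finset.mem_univ _, by rw [hx, mul_inv_cancel_left]⟩
  have hmap : ∀ A ∈ (Finset.univ : Finset (SpecialLinearGroup (Fin 2) F)),
      A • (![1, 0] : Fin 2 → F) ∈ Finset.univ.filter fun v : Fin 2 → F => v ≠ 0 := by
    intro A _
    rw [Finset.mem_filter, Ne, smul_eq_zero_iff_eq]
    exact ⟨Finset.mem_univ _, fun h => one_ne_zero (congrFun h 0)⟩
  rw [← Finset.card_univ, Finset.card_eq_sum_card_fiberwise hmap,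
    Finset.sum_congr rfl fun v hv => hfib v (Finset.mem_filter.1 hv).2, Finset.sum_const,
    card_ne_zero_vectors, smul_eq_mul, mul_comm]

theorem card_le_two_mul_card_nonsplit_traces (h2 : (2 : F) ≠ 0) :
    Fintype.card F ≤ 2 * (Finset.univ.filter fun t : F => ¬ IsSquare (t ^ 2 - 4)).card + 1 := by
  obtain ⟨T, hT⟩ : ∃ T, T = Finset.univ.filter fun t : F => IsSquare (t ^ 2 - 4) := ⟨_, rfl⟩
  have hmap : ∀ s ∈ Finset.univ.erase (0 : F), s + s⁻¹ ∈ T := by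
    intro s hs
    have hs0 : s ≠ 0 := Finset.ne_of_mem_erase hs
    rw [hT, Finset.mem_filter]
    exact ⟨Finset.mem_univ _, s - s⁻¹, by field_simp; ring⟩
  have hfib : ∀ t ∈ T, 2 ≤ ((Finset.univ.erase (0 : F)).filter fun s => s + s⁻¹ = t).card +
      (if t = 2 then 1 else 0) + (if t = -2 then 1 else 0) := by
    intro t ht
    rw [hT, Finset.mem_filter] at ht
    obtain ⟨-, y, hy⟩ := ht
    have hprod : (t + y) / 2 * ((t - y) / 2) = 1 := by
      have h4 : (4 : F) ≠ 0 := by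
        have : (4 : F) = 2 * 2 := by norm_num
        rw [this]; exact mul_ne_zero h2 h2
      field_simp
      linear_combination hy
    have hmem : ∀ z : F, z ^ 2 = y ^ 2 → (t + z) / 2 ∈
        (Finset.univ.erase (0 : F)).filter fun s => s + s⁻¹ = t := by
      intro z hz
      have hprod : (t + z) / 2 * ((t - z) / 2) = 1 := by
        rw [← hprod]
        field_simp
        linear_combination -hz
      rw [Finset.mem_filter, ← eq_inv_of_mul_eq_one_right hprod]
      refine ⟨Finset.mem_erase.2 ⟨left_ne_zero_of_mul_eq_one hprod, Finset.mem_univ _⟩, ?_⟩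
      field_simp
      ring
    by_cases ht2 : t = 2 ∨ t = -2
    · have hpos := Finset.card_pos.2 ⟨_, hmem y rfl⟩
      rcases ht2 with h | h <;> rw [if_pos h] <;> omega
    · push Not at ht2
      have hy0 : y ≠ 0 := by
        rintro rfl
        have : (t - 2) * (t + 2) = 0 := by linear_combination hy
        rcases mul_eq_zero.1 this with h | h
        · exact ht2.1 (sub_eq_zero.1 h)
        · exact ht2.2 (eq_neg_of_add_eq_zero_left h)
      have : 1 < ((Finset.univ.erase (0 : F)).filter fun s => s + s⁻¹ = t).card := by
        refine Finset.one_lt_card.2 ⟨_, hmem y rfl, _, hmem (-y) (by ring), ?_⟩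
        intro h
        field_simp at h
        have : 2 * y = 0 := by linear_combination h
        exact (mul_ne_zero h2 hy0) this
      omega
  have hsum := Finset.sum_le_sum hfib
  rw [Finset.sum_add_distrib, Finset.sum_add_distrib, ← Finset.card_eq_sum_card_fiberwise hmap,
    Finset.card_erase_of_mem (Finset.mem_univ _), Finset.card_univ, Finset.sum_const, smul_eq_mul,
    Finset.sum_ite_eq', Finset.sum_ite_eq'] at hsum
  have hle : ∀ t : F, (if t ∈ T then 1 else 0) ≤ 1 := fun t => by split_ifs <;> omega
  have h1 := hle 2
  have h3 := hle (-2)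
  have hcard := Finset.card_filter_add_card_filter_not (s := (Finset.univ : Finset F))
    (fun t : F => IsSquare (t ^ 2 - 4))
  rw [← hT, Finset.card_univ] at hcard
  have hq : 0 < Fintype.card F := Fintype.card_pos
  omega

theorem card_nonsplit_ge :
    (Finset.univ.filter fun t : F => ¬ IsSquare (t ^ 2 - 4)).card *
      (Fintype.card F * (Fintype.card F - 1)) ≤
    (Finset.univ.filter fun A : SpecialLinearGroup (Fin 2) F =>
      ¬ IsSquare (A.1.trace ^ 2 - 4)).card := by
  have hcard : Fintype.card F - 1 = (Finset.univ.erase (0 : F)).card := by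
    rw [Finset.card_erase_of_mem (Finset.mem_univ _), Finset.card_univ]
  rw [hcard, ← Finset.card_univ (α := F), ← Finset.card_product, ← Finset.card_product]
  obtain ⟨m, hm⟩ : ∃ m : F × F × F → SpecialLinearGroup (Fin 2) F, ∀ t a b, b ≠ 0 →
      (m (t, a, b)).1 = !![a, b; (a * (t - a) - 1) / b, t - a] := by
    have hdet : ∀ t a b : F, b ≠ 0 → det !![a, b; (a * (t - a) - 1) / b, t - a] = 1 := by
      intro t a b hb
      rw [det_fin_two_of]
      field_simp
      ring
    refine ⟨fun p => if hb : p.2.2 ≠ 0 then ⟨_, hdet p.1 p.2.1 p.2.2 hb⟩ else 1, ?_⟩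
    intro t a b hb
    exact congrArg Subtype.val (dif_pos hb)
  refine Finset.card_le_card_of_injOn m ?_ ?_
  · rintro ⟨t, a, b⟩ h
    simp only [Finset.coe_product, Set.mem_prod, Finset.mem_coe, Finset.mem_filter,
      Finset.mem_univ, true_and, Finset.mem_erase, and_true] at h ⊢
    rw [hm t a b h.2]
    simpa [trace_fin_two] using h.1
  · rintro ⟨t, a, b⟩ h ⟨t', a', b'⟩ h' heq
    simp only [Finset.coe_product, Set.mem_prod, Finset.mem_coe, Finset.mem_filter,
      Finset.mem_univ, true_and, Finset.mem_erase, and_true] at h h'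
    have := congrArg Subtype.val heq
    rw [hm t a b h.2, hm t' a' b' h'.2] at this
    have h00 := congrFun (congrFun this 0) 0
    have h01 := congrFun (congrFun this 0) 1
    have h11 := congrFun (congrFun this 1) 1
    simp at h00 h01 h11
    subst h00 h01
    simpa using h11

end Matrix.SpecialLinearGroup

namespace IsHalfDiscrete

open Matrix Matrix.SpecialLinearGroup

section

variable {F W : Type*} [Field F] [AddCommGroup W] [Module ℂ W]
  {ρ : Matrix.SpecialLinearGroup (Fin 2) F →* Module.End ℂ W}

/-- The squared norm of the character at `A`. -/
noncomputable def normSq (ρ : Matrix.SpecialLinearGroup (Fin 2) F →* Module.End ℂ W)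
    (A : Matrix.SpecialLinearGroup (Fin 2) F) : ℂ :=
  LinearMap.trace ℂ W (ρ A) * LinearMap.trace ℂ W (ρ A⁻¹)

theorem trace_map_conj (A g : Matrix.SpecialLinearGroup (Fin 2) F) :
    LinearMap.trace ℂ W (ρ (g * A * g⁻¹)) = LinearMap.trace ℂ W (ρ A) := by
  rw [map_mul, LinearMap.trace_mul_comm, ← map_mul, ← mul_assoc, inv_mul_cancel, one_mul]

theorem normSq_conj (A g : Matrix.SpecialLinearGroup (Fin 2) F) :
    normSq ρ (g * A * g⁻¹) = normSq ρ A := by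
  rw [normSq, normSq, trace_map_conj, show (g * A * g⁻¹)⁻¹ = g * A⁻¹ * g⁻¹ by group,
    trace_map_conj]

theorem normSq_one [FiniteDimensional ℂ W] : normSq ρ 1 = (Module.finrank ℂ W : ℂ) ^ 2 := by
  rw [normSq, inv_one, map_one, LinearMap.trace_one, sq]

end

variable {F W : Type*} [Field F] [Fintype F] [AddCommGroup W] [Module ℂ W]
  {ρ : Matrix.SpecialLinearGroup (Fin 2) F →* Module.End ℂ W}

theorem two_ne_zero (h : IsHalfDiscrete ρ) : (2 : F) ≠ 0 := by
  have := FiniteField.odd_card_of_char_ne_two (F := F)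
  intro h2
  have h3 : ringChar F = 2 := by
    rw [← Nat.prime_dvd_prime_iff_eq (CharP.char_is_prime F (ringChar F)) Nat.prime_two]
    exact (ringChar.spec F 2).1 (by exact_mod_cast h2)
  have := FiniteField.even_card_of_char_two h3
  have := h.card_mod_four
  omega

theorem map_neg (h : IsHalfDiscrete ρ) (A : Matrix.SpecialLinearGroup (Fin 2) F) :
    ρ (-A) = ρ A := by
  rw [← neg_one_mul, map_mul, h.map_neg_one, one_mul]

theorem normSq_neg (h : IsHalfDiscrete ρ) (A : Matrix.SpecialLinearGroup (Fin 2) F) :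
    normSq ρ (-A) = normSq ρ A := by
  rw [normSq, normSq, h.map_neg, show (-A)⁻¹ = -A⁻¹ from inv_neg, h.map_neg]

theorem trace_eq_zero_of_isSquare (h : IsHalfDiscrete ρ) {A : Matrix.SpecialLinearGroup (Fin 2) F}
    (hsq : IsSquare (A.1.trace ^ 2 - 4)) (ht : A.1.trace ≠ 2) (ht' : A.1.trace ≠ -2) :
    LinearMap.trace ℂ W (ρ A) = 0 := by
  obtain ⟨g, s, hs0, hs2, rfl⟩ := exists_conj_diag2_of_isSquare h.two_ne_zero hsq ht ht'
  rw [trace_map_conj, h.trace_diag2 hs0 hs2]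

theorem sum_normSq_nonsplit (h : IsHalfDiscrete ρ) :
    ∑ A with ¬ IsSquare (A.1.trace ^ 2 - 4), normSq ρ A =
      2 * (Module.finrank ℂ W : ℂ) ^ 2 * Fintype.card F := by
  have := h.finiteDimensional
  have h22 : (2 : F) ≠ -2 := by
    intro h2
    have : (2 : F) * 2 = 0 := by linear_combination h2
    exact mul_ne_zero h.two_ne_zero h.two_ne_zero this
  have hq : (Fintype.card F : ℂ) = 2 * Module.finrank ℂ W + 1 := by
    rw [← h.two_mul_finrank]; push_cast; ring
  have htot := h.sum_trace
  rw [card_fin_two_field, Nat.cast_mul, Nat.cast_sub (Nat.one_le_pow _ _ Fintype.card_pos)] at htot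
  push_cast at htot
  have htwo : ∑ A with A.1.trace = 2, normSq ρ A = (Module.finrank ℂ W : ℂ) ^ 2 +
      (Fintype.card F + 1) *
        (Fintype.card F * Module.finrank ℂ W - (Module.finrank ℂ W : ℂ) ^ 2) := by
    rw [sum_trace_eq_two _ normSq_conj, normSq_one, ← h.sum_unipotent]
    have : ∀ x : F, normSq ρ (transvection (zero_ne_one (α := Fin 2)) x) =
        LinearMap.trace ℂ W (unipotent ρ x) * LinearMap.trace ℂ W (unipotent ρ (-x)) := by
      intro x
      rw [normSq, unipotent, unipotent]
      congr 3
      rw [inv_eq_iff_mul_eq_one]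
      ext i j
      fin_cases i <;> fin_cases j <;>
        simp [transvection_coe, Matrix.mul_apply, Fin.sum_univ_two]
    simp_rw [this]
  have hneg : ∑ A with A.1.trace = -2, normSq ρ A = ∑ A with A.1.trace = 2, normSq ρ A := by
    refine Finset.sum_nbij' (fun A => -A) (fun A => -A) ?_ ?_ ?_ ?_ ?_
    · intro A hA
      simp only [Finset.mem_filter, Finset.mem_univ, true_and] at hA ⊢
      rw [coe_neg, trace_neg, hA, neg_neg]
    · intro A hA
      simp only [Finset.mem_filter, Finset.mem_univ, true_and] at hA ⊢
      rw [coe_neg, trace_neg, hA]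
    · simp
    · simp
    · intro A _
      exact (h.normSq_neg A).symm
  have hsplit : ∀ A, normSq ρ A = (if A.1.trace = 2 then normSq ρ A else 0) +
      (if A.1.trace = -2 then normSq ρ A else 0) +
      (if ¬ IsSquare (A.1.trace ^ 2 - 4) then normSq ρ A else 0) := by
    intro A
    by_cases h1 : A.1.trace = 2
    · have : IsSquare (A.1.trace ^ 2 - 4) := ⟨0, by rw [h1]; norm_num⟩
      rw [if_pos h1, if_neg (by rw [h1]; exact h22), if_neg (not_not.2 this)]
      ring
    by_cases h2 : A.1.trace = -2
    · have : IsSquare (A.1.trace ^ 2 - 4) := ⟨0, by rw [h2]; norm_num⟩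
      rw [if_neg h1, if_pos h2, if_neg (not_not.2 this)]
      ring
    rw [if_neg h1, if_neg h2]
    by_cases h3 : IsSquare (A.1.trace ^ 2 - 4)
    · rw [if_neg (not_not.2 h3), normSq, h.trace_eq_zero_of_isSquare h3 h1 h2]
      ring
    · rw [if_pos h3]
      ring
  have hall : ∑ A, normSq ρ A = ∑ A with A.1.trace = 2, normSq ρ A +
      ∑ A with A.1.trace = -2, normSq ρ A +
      ∑ A with ¬ IsSquare (A.1.trace ^ 2 - 4), normSq ρ A := by
    rw [Finset.sum_congr rfl fun A _ => hsplit A, Finset.sum_add_distrib, Finset.sum_add_distrib,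
      ← Finset.sum_filter, ← Finset.sum_filter, ← Finset.sum_filter]
  rw [hneg, htwo] at hall
  change ∑ A, normSq ρ A = _ at htot
  rw [htot] at hall
  rw [hq] at hall ⊢
  linear_combination -hall

theorem card_nonsplit_ge (h : IsHalfDiscrete ρ) :
    2 * Module.finrank ℂ W ^ 2 * Fintype.card F ≤
      (Finset.univ.filter fun A : Matrix.SpecialLinearGroup (Fin 2) F =>
        ¬ IsSquare (A.1.trace ^ 2 - 4)).card := by
  refine le_trans ?_ Matrix.SpecialLinearGroup.card_nonsplit_ge
  have h1 := card_le_two_mul_card_nonsplit_traces h.two_ne_zero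
  have h2 := h.two_mul_finrank
  have h3 : Module.finrank ℂ W ≤
      (Finset.univ.filter fun t : F => ¬ IsSquare (t ^ 2 - 4)).card := by omega
  have h4 : Fintype.card F - 1 = 2 * Module.finrank ℂ W := by omega
  rw [h4]
  calc _ = Module.finrank ℂ W * (Fintype.card F * (2 * Module.finrank ℂ W)) := by ring
    _ ≤ _ := Nat.mul_le_mul_right _ h3

end IsHalfDiscrete

namespace Matrix.SpecialLinearGroup

open Matrix

variable {F : Type*} [Field F]

theorem apply_one_zero_ne_zero {A : SpecialLinearGroup (Fin 2) F}
    (hA : ¬ IsSquare (A.1.trace ^ 2 - 4)) : A.1 1 0 ≠ 0 := by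
  intro h
  apply hA
  have hdet := A.2
  rw [det_fin_two, h] at hdet
  rw [trace_fin_two]
  exact ⟨A.1 0 0 - A.1 1 1, by linear_combination 4 * hdet⟩

theorem exists_eq_smul_add_smul {A c : SpecialLinearGroup (Fin 2) F}
    (hA : ¬ IsSquare (A.1.trace ^ 2 - 4)) (hc : A * c = c * A) :
    ∃ x y : F, c.1 = x • (1 : Matrix (Fin 2) (Fin 2) F) + y • A.1 := by
  have h10 := apply_one_zero_ne_zero hA
  have hc' := congrArg Subtype.val hc
  rw [coe_mul, coe_mul] at hc'
  have h00 := congrFun (congrFun hc' 0) 0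
  have h10' := congrFun (congrFun hc' 1) 0
  simp only [Matrix.mul_apply, Fin.sum_univ_two] at h00 h10'
  refine ⟨c.1 0 0 - c.1 1 0 / A.1 1 0 * A.1 0 0, c.1 1 0 / A.1 1 0, ?_⟩
  ext i j
  fin_cases i <;> fin_cases j <;> simp <;> field_simp
  · linear_combination -h00
  · linear_combination -h10'

theorem norm_eq_one {A c : SpecialLinearGroup (Fin 2) F} {x y : F}
    (h : c.1 = x • (1 : Matrix (Fin 2) (Fin 2) F) + y • A.1) :
    x ^ 2 + A.1.trace * x * y + y ^ 2 = 1 := by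
  have hdet := A.2
  have hdet' := c.2
  rw [det_fin_two] at hdet hdet'
  rw [h] at hdet'
  simp at hdet'
  rw [trace_fin_two]
  linear_combination hdet' - y ^ 2 * hdet

theorem commute_iff_of_eq_smul_add_smul {A c e : SpecialLinearGroup (Fin 2) F} {x y : F}
    (h : c.1 = x • (1 : Matrix (Fin 2) (Fin 2) F) + y • A.1) (hy : y ≠ 0) :
    c * e = e * c ↔ A * e = e * A := by
  have hval : ∀ B C : SpecialLinearGroup (Fin 2) F, B * C = C * B ↔ B.1 * C.1 = C.1 * B.1 :=
    fun B C => by rw [← coe_mul, ← coe_mul]; exact Subtype.ext_iff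
  rw [hval, hval, h]
  simp only [add_mul, mul_add, one_mul, mul_one, Matrix.smul_mul, Matrix.mul_smul]
  rw [add_right_inj, (smul_right_injective _ hy).eq_iff]

theorem trace_eq_of_eq_smul_add_smul {A c : SpecialLinearGroup (Fin 2) F} {x y : F}
    (h : c.1 = x • (1 : Matrix (Fin 2) (Fin 2) F) + y • A.1) :
    c.1.trace ^ 2 - 4 = y ^ 2 * (A.1.trace ^ 2 - 4) := by
  have h1 := norm_eq_one h
  have h2 : c.1.trace = 2 * x + y * A.1.trace := by
    rw [h, trace_add, trace_smul, trace_smul, trace_one]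
    simp
    ring
  rw [h2]
  linear_combination 4 * h1

theorem eq_one_or_eq_neg_one_of_smul {c : SpecialLinearGroup (Fin 2) F} {x : F}
    (h : c.1 = x • (1 : Matrix (Fin 2) (Fin 2) F)) : c = 1 ∨ c = -1 := by
  have hdet := c.2
  rw [h] at hdet
  have hx : x ^ 2 = 1 := by simpa using hdet
  rcases sq_eq_one_iff.1 hx with rfl | rfl
  · left
    ext i j
    rw [h]
    simp
  · right
    ext i j
    rw [h, coe_neg, coe_one]
    simp

/-- The elements other than `±1` of a nonsplit torus generate the same torus. -/
theorem nonsplit_of_commute {A c : SpecialLinearGroup (Fin 2) F}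
    (hA : ¬ IsSquare (A.1.trace ^ 2 - 4)) (hc : A * c = c * A) (h1 : c ≠ 1) (h2 : c ≠ -1) :
    ¬ IsSquare (c.1.trace ^ 2 - 4) ∧ ∀ e, c * e = e * c ↔ A * e = e * A := by
  obtain ⟨x, y, h⟩ := exists_eq_smul_add_smul hA hc
  have hy : y ≠ 0 := by
    rintro rfl
    rw [zero_smul, add_zero] at h
    rcases eq_one_or_eq_neg_one_of_smul h with h | h
    · exact h1 h
    · exact h2 h
  refine ⟨?_, fun e => commute_iff_of_eq_smul_add_smul h hy⟩
  rw [trace_eq_of_eq_smul_add_smul h]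
  rintro ⟨z, hz⟩
  exact hA ⟨z / y, by field_simp; linear_combination hz⟩

theorem norm_form_ne_zero {t k : F} (ht : ¬ IsSquare (t ^ 2 - 4)) : k ^ 2 + t * k + 1 ≠ 0 := by
  intro h
  exact ht ⟨2 * k + t, by linear_combination -4 * h⟩

theorem card_conic [Fintype F] (h2 : (2 : F) ≠ 0) {t : F} (ht : ¬ IsSquare (t ^ 2 - 4)) :
    (Finset.univ.filter fun p : F × F => p.1 ^ 2 + t * p.1 * p.2 + p.2 ^ 2 = 1).card =
      Fintype.card F + 1 := by
  rw [← Fintype.card_option, ← Finset.card_univ]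
  symm
  obtain ⟨Y, hY⟩ : ∃ Y : F → F, ∀ k, Y k * (k ^ 2 + t * k + 1) = -(2 * k + t) :=
    ⟨fun k => -(2 * k + t) / (k ^ 2 + t * k + 1), fun k => div_mul_cancel₀ _ (norm_form_ne_zero ht)⟩
  have hzero : ∀ k, Y k = 0 → 2 * k + t = 0 := fun k hk => by
    have := hY k
    rw [hk] at this
    linear_combination this
  refine Finset.card_bij (fun o _ => o.elim ((-1 : F), (0 : F)) fun k =>
    (1 + k * Y k, Y k)) ?_ ?_ ?_
  · rintro (_ | k) _
    · simp
    · simp only [Option.elim, Finset.mem_filter, Finset.mem_univ, true_and]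
      linear_combination Y k * hY k
  · rintro (_ | k) _ (_ | l) _ h
    · rfl
    · exfalso
      simp only [Option.elim, Prod.mk.injEq] at h
      rw [← h.2] at h
      exact h2 (by linear_combination -h.1)
    · exfalso
      simp only [Option.elim, Prod.mk.injEq] at h
      rw [h.2] at h
      exact h2 (by linear_combination h.1)
    · simp only [Option.elim, Prod.mk.injEq] at h
      obtain ⟨h1, h3⟩ := h
      congr 1
      by_cases hy : Y k = 0
      · exact mul_left_cancel₀ h2 (by linear_combination hzero k hy - hzero l (h3 ▸ hy))
      · rw [← h3] at h1
        exact mul_right_cancel₀ hy (add_left_cancel h1)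
  · rintro ⟨x, y⟩ hxy
    simp only [Finset.mem_filter, Finset.mem_univ, true_and] at hxy
    by_cases hy : y = 0
    · subst hy
      have hx : x ^ 2 = 1 := by linear_combination hxy
      rcases sq_eq_one_iff.1 hx with rfl | rfl
      · refine ⟨some (-t / 2), Finset.mem_univ _, ?_⟩
        have hY0 : Y (-t / 2) = 0 := by
          have h3 := hY (-t / 2)
          have h4 : -(2 * (-t / 2) + t) = 0 := by field_simp; ring
          rw [h4] at h3
          exact (mul_eq_zero.1 h3).resolve_right (norm_form_ne_zero ht)
        simp [hY0]
      · exact ⟨none, Finset.mem_univ _, rfl⟩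
    · refine ⟨some ((x - 1) / y), Finset.mem_univ _, ?_⟩
      obtain ⟨k, hk⟩ : ∃ k, k = (x - 1) / y := ⟨_, rfl⟩
      have hx : x = 1 + k * y := by rw [hk]; field_simp; ring
      rw [← hk]
      have h3 : y * (k ^ 2 + t * k + 1) = -(2 * k + t) := by
        rw [hx] at hxy
        exact mul_left_cancel₀ hy (by linear_combination hxy)
      have h4 : Y k = y := mul_right_cancel₀ (norm_form_ne_zero ht) ((hY k).trans h3.symm)
      simp [h4, hx]

theorem card_commute [Fintype F] (h2 : (2 : F) ≠ 0) {A : SpecialLinearGroup (Fin 2) F}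
    (hA : ¬ IsSquare (A.1.trace ^ 2 - 4)) :
    (Finset.univ.filter fun c : SpecialLinearGroup (Fin 2) F => A * c = c * A).card =
      Fintype.card F + 1 := by
  rw [← card_conic h2 hA]
  have h10 := apply_one_zero_ne_zero hA
  have hdet : ∀ p ∈ Finset.univ.filter fun p : F × F =>
      p.1 ^ 2 + A.1.trace * p.1 * p.2 + p.2 ^ 2 = 1,
      (p.1 • (1 : Matrix (Fin 2) (Fin 2) F) + p.2 • A.1).det = 1 := by
    intro p hp
    have h1 := (Finset.mem_filter.1 hp).2
    have h3 := A.2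
    rw [trace_fin_two] at h1
    rw [det_fin_two] at h3 ⊢
    simp
    linear_combination h1 + p.2 ^ 2 * h3
  symm
  refine Finset.card_bij (fun p hp => ⟨_, hdet p hp⟩) ?_ ?_ ?_
  · intro p hp
    refine Finset.mem_filter.2 ⟨Finset.mem_univ _, Subtype.ext ?_⟩
    change A.1 * (p.1 • 1 + p.2 • A.1) = (p.1 • 1 + p.2 • A.1) * A.1
    simp [mul_add, add_mul]
  · intro p hp p' hp' h
    have h3 := congrArg Subtype.val h
    have h4 := congrFun (congrFun h3 1) 0
    have h5 := congrFun (congrFun h3 0) 0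
    simp [h10] at h4 h5
    rw [h4] at h5
    exact Prod.ext (add_right_cancel h5) h4
  · intro c hc
    obtain ⟨x, y, h⟩ := exists_eq_smul_add_smul hA (Finset.mem_filter.1 hc).2
    refine ⟨(x, y), ?_, Subtype.ext h.symm⟩
    rw [Finset.mem_filter]
    exact ⟨Finset.mem_univ _, norm_eq_one h⟩

theorem isCyclic_centralizer [Finite F] (h2 : (2 : F) ≠ 0) {A : SpecialLinearGroup (Fin 2) F}
    (hA : ¬ IsSquare (A.1.trace ^ 2 - 4)) : IsCyclic (Subgroup.centralizer {A}) := by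
  obtain ⟨K, i1, i2, i3⟩ : ∃ (K : Type _) (_ : Field K) (_ : Algebra F K), IsAlgClosed K :=
    ⟨AlgebraicClosure F, inferInstance, inferInstance, inferInstance⟩
  have h10 := apply_one_zero_ne_zero hA
  have hK2 : (2 : K) ≠ 0 := by
    intro h
    apply h2
    apply (algebraMap F K).injective
    rw [map_ofNat, h, map_zero]
  obtain ⟨δ, hδ⟩ := IsAlgClosed.exists_eq_mul_self (algebraMap F K (A.1.trace ^ 2 - 4))
  obtain ⟨α, hα⟩ : ∃ α, α = (algebraMap F K A.1.trace + δ) / 2 := ⟨_, rfl⟩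
  have hroot : α ^ 2 = algebraMap F K A.1.trace * α - 1 := by
    rw [hα]
    simp only [map_sub, map_pow, map_ofNat] at hδ
    field_simp
    linear_combination -hδ
  have hmem : ∀ c : Subgroup.centralizer {A}, ∃ x y : F,
      c.1.1 = x • (1 : Matrix (Fin 2) (Fin 2) F) + y • A.1 := fun c =>
    exists_eq_smul_add_smul hA (Subgroup.mem_centralizer_singleton_iff.1 c.2).symm
  obtain ⟨μ, hμ⟩ : ∃ μ : SpecialLinearGroup (Fin 2) F → K, ∀ c x y,
      c.1 = x • (1 : Matrix (Fin 2) (Fin 2) F) + y • A.1 →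
        μ c = algebraMap F K x + algebraMap F K y * α := by
    refine ⟨fun c => algebraMap F K (c.1 0 0 - c.1 1 0 / A.1 1 0 * A.1 0 0) +
      algebraMap F K (c.1 1 0 / A.1 1 0) * α, fun c x y h => ?_⟩
    have h00 : c.1 0 0 = x + y * A.1 0 0 := by rw [h]; simp
    have h10' : c.1 1 0 / A.1 1 0 = y := by rw [h]; simp [h10]
    simp only [h10', h00, add_sub_cancel_right]
  let f : Subgroup.centralizer {A} →* K :=
    { toFun := fun c => μ c
      map_one' := by
        rw [hμ _ 1 0 (by simp)]
        simp
      map_mul' := fun c c' => by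
        obtain ⟨x, y, h⟩ := hmem c
        obtain ⟨x', y', h'⟩ := hmem c'
        have hch : A.1 * A.1 = A.1.trace • A.1 - 1 := by
          have hdet := A.2
          rw [det_fin_two] at hdet
          ext i j
          fin_cases i <;> fin_cases j <;>
            simp [Matrix.mul_apply, Fin.sum_univ_two, trace_fin_two]
          · linear_combination -hdet
          · ring
          · ring
          · linear_combination -hdet
        rw [hμ _ _ _ h, hμ _ _ _ h', hμ _ (x * x' - y * y') (x * y' + x' * y + y * y' * A.1.trace)]
        · simp only [map_add, map_sub, map_mul]
          linear_combination -algebraMap F K y * algebraMap F K y' * hroot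
        · change c.1.1 * c'.1.1 = _
          rw [h, h']
          simp only [add_mul, mul_add, Matrix.smul_mul, Matrix.mul_smul, Matrix.one_mul,
            Matrix.mul_one, hch]
          module }
  refine isCyclic_of_injective_ringHom f ?_
  rw [injective_iff_map_eq_one]
  intro c hc
  obtain ⟨x, y, h⟩ := hmem c
  have hc' : algebraMap F K x + algebraMap F K y * α = 1 := by rw [← hμ _ _ _ h]; exact hc
  have hy : y = 0 := by
    by_contra hy
    have hy' : algebraMap F K y ≠ 0 := by simpa using hy
    have hα' : α = algebraMap F K ((1 - x) / y) := by
      rw [map_div₀, map_sub, map_one]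
      field_simp
      linear_combination hc'
    rw [hα'] at hroot
    have : ((1 - x) / y) ^ 2 = A.1.trace * ((1 - x) / y) - 1 := by
      apply (algebraMap F K).injective
      simpa using hroot
    exact norm_form_ne_zero (t := A.1.trace) (k := -((1 - x) / y)) hA (by linear_combination this)
  subst hy
  have hx : x = 1 := by
    apply (algebraMap F K).injective
    simpa using hc'
  subst hx
  ext i j
  simp [h]

theorem exists_generator_centralizer [Fintype F] (h2 : (2 : F) ≠ 0)
    {A : SpecialLinearGroup (Fin 2) F} (hA : ¬ IsSquare (A.1.trace ^ 2 - 4)) :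
    ∃ c, orderOf c = Fintype.card F + 1 ∧ Subgroup.centralizer {A} = Subgroup.zpowers c := by
  have := isCyclic_centralizer h2 hA
  obtain ⟨c, hc⟩ := (Subgroup.isCyclic_iff_exists_zpowers_eq_top _).1 this
  refine ⟨c, ?_, hc.symm⟩
  rw [← Nat.card_zpowers, hc, ← card_commute h2 hA]
  rw [Nat.card_eq_fintype_card, Fintype.card_subtype]
  simp [Subgroup.mem_centralizer_singleton_iff, eq_comm]

end Matrix.SpecialLinearGroup

/-- Power sums of all but one of the `n`-th roots of unity, when their product is `1`. -/
theorem Complex.sum_pow_of_injective_of_prod_eq_one {n d k : ℕ} (hn : Even n) (hd : d + 1 = n)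
    {r : Fin d → ℂ} (hinj : Function.Injective r) (hr : ∀ i, r i ^ n = 1) (hprod : ∏ i, r i = 1)
    (hk : ¬ n ∣ k) : ∑ i, r i ^ k = -(-1) ^ k := by
  have hn0 : n ≠ 0 := by omega
  have hpos : 0 < n := by omega
  obtain ⟨ζ, hζ⟩ : ∃ ζ : ℂ, IsPrimitiveRoot ζ n := ⟨_, Complex.isPrimitiveRoot_exp n hn0⟩
  obtain ⟨R, hR⟩ : ∃ R, R = Polynomial.nthRootsFinset n (1 : ℂ) := ⟨_, rfl⟩
  have hmem : ∀ z, z ∈ R ↔ z ^ n = 1 := fun z => by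
    rw [hR, Polynomial.mem_nthRootsFinset hpos]
  have hRprod : ∏ z ∈ R, z = -1 := by
    have h := congrArg (Polynomial.eval 0) (Polynomial.X_pow_sub_one_eq_prod hpos hζ)
    rw [← hR, Polynomial.eval_prod] at h
    simp only [Polynomial.eval_sub, Polynomial.eval_pow, Polynomial.eval_X, Polynomial.eval_one,
      zero_pow hn0, Polynomial.eval_C, zero_sub] at h
    rw [Finset.prod_neg, hR, hζ.card_nthRootsFinset, hn.neg_one_pow, one_mul, ← hR] at h
    exact h.symm
  have hRsum : ∑ z ∈ R, z ^ k = 0 := by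
    have h : ∑ z ∈ R, z ^ k = ζ ^ k * ∑ z ∈ R, z ^ k := by
      rw [Finset.mul_sum]
      have hζ0 : ζ ≠ 0 := hζ.ne_zero hn0
      refine Finset.sum_nbij' (fun z => ζ⁻¹ * z) (fun z => ζ * z) ?_ ?_ ?_ ?_ ?_
      · intro z hz
        rw [hmem] at hz ⊢
        rw [mul_pow, inv_pow, hζ.pow_eq_one, hz, inv_one, one_mul]
      · intro z hz
        rw [hmem] at hz ⊢
        rw [mul_pow, hζ.pow_eq_one, hz, one_mul]
      · intro z _
        rw [mul_inv_cancel_left₀ hζ0]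
      · intro z _
        rw [inv_mul_cancel_left₀ hζ0]
      · intro z _
        rw [← mul_pow, mul_inv_cancel_left₀ hζ0]
    have hne : ζ ^ k - 1 ≠ 0 := by
      rw [sub_ne_zero, Ne, hζ.pow_eq_one_iff_dvd]
      exact hk
    refine (mul_eq_zero.1 ?_).resolve_left hne
    rw [sub_mul, one_mul, ← h, sub_self]
  have hsub : Finset.univ.image r ⊆ R := by
    intro z hz
    obtain ⟨i, -, rfl⟩ := Finset.mem_image.1 hz
    exact (hmem _).2 (hr i)
  have hcard : (R \ Finset.univ.image r).card = 1 := by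
    rw [Finset.card_sdiff_of_subset hsub, hR, hζ.card_nthRootsFinset,
      Finset.card_image_of_injective _ hinj, Finset.card_univ, Fintype.card_fin]
    omega
  obtain ⟨l, hl⟩ := Finset.card_eq_one.1 hcard
  have h1 := Finset.prod_sdiff (f := fun z => z) hsub
  have h2 := Finset.sum_sdiff (f := fun z => z ^ k) hsub
  rw [hl, Finset.prod_singleton, Finset.prod_image hinj.injOn, hprod, hRprod, mul_one] at h1
  rw [hl, Finset.sum_singleton, Finset.sum_image hinj.injOn, hRsum, h1] at h2
  exact eq_neg_of_add_eq_zero_right h2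

/-- Orthogonality of the eigenvalues of an operator of finite order. -/
theorem Complex.sum_range_sum_pow_mul_sum_inv_pow {ι : Type*} [Fintype ι] {N : ℕ} {r : ι → ℂ}
    (hr0 : ∀ i, r i ≠ 0) (hr : ∀ i, r i ^ N = 1) :
    ∑ k ∈ Finset.range N, (∑ i, r i ^ k) * (∑ i, (r i)⁻¹ ^ k) =
      N * (Finset.univ.filter fun p : ι × ι => r p.1 = r p.2).card := by
  have h : ∀ p : ι × ι, ∑ k ∈ Finset.range N, r p.1 ^ k * (r p.2)⁻¹ ^ k =
      if r p.1 = r p.2 then (N : ℂ) else 0 := by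
    intro p
    simp_rw [← mul_pow]
    by_cases hp : r p.1 = r p.2
    · rw [if_pos hp, hp, mul_inv_cancel₀ (hr0 _)]
      simp
    · rw [if_neg hp, geom_sum_eq, mul_pow, inv_pow, hr, hr]
      · simp
      · intro h
        exact hp (eq_of_div_eq_one (by rwa [div_eq_mul_inv]))
  simp_rw [Fintype.sum_mul_sum, ← Fintype.sum_prod_type']
  rw [Finset.sum_comm, Finset.sum_congr rfl fun p _ => h p, ← Finset.sum_filter, Finset.sum_const,
    nsmul_eq_mul, mul_comm]

theorem Fintype.card_le_card_filter_eq {ι α : Type*} [Fintype ι] (r : ι → α) :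
    Fintype.card ι ≤ (Finset.univ.filter fun p : ι × ι => r p.1 = r p.2).card := by
  rw [← Finset.card_univ]
  exact Finset.card_le_card_of_injOn (fun i => (i, i)) (by simp)
    fun i _ j _ h => congrArg Prod.fst h

theorem Function.injective_of_card_filter_eq_le {ι α : Type*} [Fintype ι] {r : ι → α}
    (h : (Finset.univ.filter fun p : ι × ι => r p.1 = r p.2).card ≤ Fintype.card ι) :
    Function.Injective r := by
  have hsub : (Finset.univ.image fun i : ι => (i, i)) ⊆
      Finset.univ.filter fun p : ι × ι => r p.1 = r p.2 := by
    intro p hp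
    obtain ⟨i, -, rfl⟩ := Finset.mem_image.1 hp
    simp
  have heq := Finset.eq_of_subset_of_card_le hsub (by
    rwa [Finset.card_image_of_injective _ fun i j h => congrArg Prod.fst h, Finset.card_univ])
  intro i j hij
  have hmem : (i, j) ∈ Finset.univ.image fun i : ι => (i, i) := by
    rw [heq]
    simpa using hij
  obtain ⟨l, -, hl⟩ := Finset.mem_image.1 hmem
  rw [Prod.mk.injEq] at hl
  rw [← hl.1, ← hl.2]

namespace IsHalfDiscrete

open Matrix Matrix.SpecialLinearGroup

variable {F W : Type*} [Field F] [Fintype F] [AddCommGroup W] [Module ℂ W]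
  {ρ : Matrix.SpecialLinearGroup (Fin 2) F →* Module.End ℂ W}

theorem det_eq_one (h : IsHalfDiscrete ρ) (A : Matrix.SpecialLinearGroup (Fin 2) F) :
    LinearMap.det (ρ A) = 1 := by
  obtain ⟨a, ha0, ha⟩ : ∃ a : F, a ≠ 0 ∧ a ^ 2 ≠ 1 := by
    by_contra hcon
    push Not at hcon
    have hsub : (Finset.univ : Finset F) ⊆ {0, 1, -1} := by
      intro a _
      by_cases ha : a = 0
      · simp [ha]
      · rcases sq_eq_one_iff.1 (hcon a ha) with h | h <;> simp [h]
    have := (Finset.card_le_card hsub).trans Finset.card_le_three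
    rw [Finset.card_univ] at this
    have := h.three_lt_card
    omega
  have hmem : A ∈ ((LinearMap.det (M := W)).comp ρ).toHomUnits.ker :=
    Abelianization.commutator_subset_ker _ (by rw [SL2.commutator_eq_top ha0 ha]; trivial)
  have := congrArg Units.val (MonoidHom.mem_ker.1 hmem)
  simpa using this

/-- The eigenvalues of a generator of a nonsplit torus. -/
theorem exists_torus_eigenvalues (h : IsHalfDiscrete ρ) {A : Matrix.SpecialLinearGroup (Fin 2) F}
    (hA : ¬ IsSquare (A.1.trace ^ 2 - 4)) :
    ∃ (c : Matrix.SpecialLinearGroup (Fin 2) F) (r : Fin (Module.finrank ℂ W) → ℂ),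
      orderOf c = 2 * (Module.finrank ℂ W + 1) ∧
      Subgroup.centralizer {A} = Subgroup.zpowers c ∧
      c ^ (Module.finrank ℂ W + 1) = -1 ∧
      (∀ i, r i ^ (Module.finrank ℂ W + 1) = 1) ∧
      (∀ k, LinearMap.trace ℂ W (ρ (c ^ k)) = ∑ i, r i ^ k) ∧ ∏ i, r i = 1 := by
  have := h.finiteDimensional
  obtain ⟨c, hc, hcen⟩ := exists_generator_centralizer h.two_ne_zero hA
  rw [← h.two_mul_finrank] at hc
  have hc' : orderOf c = 2 * (Module.finrank ℂ W + 1) := by rw [hc]; ring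
  have hne : (-1 : Matrix.SpecialLinearGroup (Fin 2) F) ≠ 1 := by
    intro h1
    have h2 := congrArg (fun B => B.1 0 0) h1
    simp at h2
    exact h.two_ne_zero (by linear_combination -h2)
  have hpow : c ^ (Module.finrank ℂ W + 1) = -1 := by
    have hmem : (-1 : Matrix.SpecialLinearGroup (Fin 2) F) ∈ Subgroup.zpowers c := by
      rw [← hcen, Subgroup.mem_centralizer_singleton_iff]
      simp
    rw [mem_zpowers_iff_mem_range_orderOf] at hmem
    obtain ⟨k, hk, hk'⟩ := Finset.mem_image.1 hmem
    simp only [Finset.mem_range] at hk hk'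
    have hk2 : c ^ (2 * k) = 1 := by
      rw [mul_comm, pow_mul, hk']
      simp
    have hdvd := orderOf_dvd_of_pow_eq_one hk2
    rw [hc'] at hdvd hk
    obtain ⟨l, hl⟩ := (Nat.mul_dvd_mul_iff_left two_pos).1 hdvd
    have hl2 : l < 2 := by
      by_contra hcon
      have : (Module.finrank ℂ W + 1) * 2 ≤ k := by
        rw [hl]; exact Nat.mul_le_mul_left _ (by omega)
      omega
    have hl1 : l = 1 := by
      have : l ≠ 0 := by
        rintro rfl
        rw [mul_zero] at hl
        rw [hl, pow_zero] at hk'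
        exact hne hk'.symm
      omega
    rw [hl1, mul_one] at hl
    rw [← hl, hk']
  obtain ⟨r, hr, htr, hdet⟩ := Module.End.exists_eigenvalues_of_pow_eq_one (ρ c)
    (Nat.succ_ne_zero (Module.finrank ℂ W)) (by
      rw [← map_pow, Nat.succ_eq_add_one, hpow, h.map_neg_one])
  refine ⟨c, r, hc', hcen, hpow, hr, fun k => ?_, ?_⟩
  · rw [map_pow, htr]
  · rw [← hdet, h.det_eq_one]

theorem sum_normSq_torus {A c : Matrix.SpecialLinearGroup (Fin 2) F}
    {r : Fin (Module.finrank ℂ W) → ℂ} (hc : orderOf c = 2 * (Module.finrank ℂ W + 1))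
    (hcen : Subgroup.centralizer {A} = Subgroup.zpowers c)
    (hr : ∀ i, r i ^ (Module.finrank ℂ W + 1) = 1)
    (htr : ∀ k, LinearMap.trace ℂ W (ρ (c ^ k)) = ∑ i, r i ^ k) :
    ∑ e with A * e = e * A, normSq ρ e = (2 * (Module.finrank ℂ W + 1) : ℕ) *
      ((Finset.univ.filter fun p : Fin (Module.finrank ℂ W) × Fin (Module.finrank ℂ W) =>
        r p.1 = r p.2).card : ℂ) := by
  have hr0 : ∀ i, r i ≠ 0 := fun i hi => by
    have := hr i
    rw [hi, zero_pow (Nat.succ_ne_zero _)] at this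
    exact zero_ne_one this
  have hr2 : ∀ i, r i ^ (2 * (Module.finrank ℂ W + 1)) = 1 := fun i => by
    rw [mul_comm, pow_mul, hr, one_pow]
  have hset : (Finset.univ.filter fun e => A * e = e * A) =
      (Finset.range (orderOf c)).image (c ^ ·) := by
    ext e
    rw [← mem_zpowers_iff_mem_range_orderOf, ← hcen, Subgroup.mem_centralizer_singleton_iff]
    simp [eq_comm]
  rw [hset, Finset.sum_image (by simpa using pow_injOn_Iio_orderOf), hc,
    ← Complex.sum_range_sum_pow_mul_sum_inv_pow hr0 hr2]
  refine Finset.sum_congr rfl fun k _ => ?_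
  have hinv : (c ^ k)⁻¹ = c ^ ((2 * (Module.finrank ℂ W + 1) - 1) * k) := by
    have : k + (2 * (Module.finrank ℂ W + 1) - 1) * k = orderOf c * k := by
      rw [hc, Nat.sub_mul, one_mul, Nat.add_sub_cancel' (Nat.le_mul_of_pos_left _ (by omega))]
    rw [inv_eq_iff_mul_eq_one, ← pow_add, this, pow_mul, pow_orderOf_eq_one, one_pow]
  rw [normSq, htr, hinv, htr]
  congr 1
  refine Finset.sum_congr rfl fun i _ => ?_
  rw [pow_mul]
  congr 1
  refine eq_inv_of_mul_eq_one_left ?_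
  rw [← pow_succ, ← hr2 i]
  congr 1

end IsHalfDiscrete

namespace Matrix.SpecialLinearGroup

open Matrix

variable {F : Type*} [Field F] [Fintype F]

theorem sum_commute_eq (h2 : (2 : F) ≠ 0) {A : SpecialLinearGroup (Fin 2) F}
    (hA : ¬ IsSquare (A.1.trace ^ 2 - 4)) (f : SpecialLinearGroup (Fin 2) F → ℂ) :
    ∑ e with A * e = e * A, f e =
      ∑ e with ¬ IsSquare (e.1.trace ^ 2 - 4), (if A * e = e * A then f e else 0) +
        f 1 + f (-1) := by
  have hne : (1 : SpecialLinearGroup (Fin 2) F) ≠ -1 := by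
    intro h1
    have h3 := congrArg (fun B => B.1 0 0) h1
    simp at h3
    exact h2 (by linear_combination h3)
  have h : ∀ e, (if A * e = e * A then f e else 0) =
      (if ¬ IsSquare (e.1.trace ^ 2 - 4) then (if A * e = e * A then f e else 0) else 0) +
        (if e = 1 then f e else 0) + (if e = -1 then f e else 0) := by
    intro e
    by_cases h1 : e = 1
    · subst h1
      have hsq : IsSquare ((1 : SpecialLinearGroup (Fin 2) F).1.trace ^ 2 - 4) :=
        ⟨0, by simp; norm_num⟩
      rw [if_neg (not_not.2 hsq), if_pos rfl, if_neg hne, if_pos (by simp)]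
      ring
    by_cases h3 : e = -1
    · subst h3
      have hsq : IsSquare ((-1 : SpecialLinearGroup (Fin 2) F).1.trace ^ 2 - 4) :=
        ⟨0, by simp; norm_num⟩
      rw [if_neg (not_not.2 hsq), if_neg h1, if_pos rfl, if_pos (by simp)]
      ring
    rw [if_neg h1, if_neg h3, add_zero, add_zero]
    by_cases hc : A * e = e * A
    · rw [if_pos hc, if_pos (nonsplit_of_commute hA hc h1 h3).1]
    · simp [hc]
  rw [Finset.sum_filter, Finset.sum_congr rfl fun e _ => h e, Finset.sum_add_distrib,
    Finset.sum_add_distrib, ← Finset.sum_filter,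
    Finset.sum_ite_eq' Finset.univ (1 : SpecialLinearGroup (Fin 2) F),
    Finset.sum_ite_eq' Finset.univ (-1 : SpecialLinearGroup (Fin 2) F)]
  simp

/-- Each nonsplit element lies in a unique nonsplit torus. -/
theorem sum_nonsplit_sum_commute (h2 : (2 : F) ≠ 0) (f : SpecialLinearGroup (Fin 2) F → ℂ) :
    ∑ A : SpecialLinearGroup (Fin 2) F with ¬ IsSquare (A.1.trace ^ 2 - 4),
      ∑ e : SpecialLinearGroup (Fin 2) F with ¬ IsSquare (e.1.trace ^ 2 - 4),
        (if A * e = e * A then f e else 0) =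
      (Fintype.card F - 1) *
        ∑ A : SpecialLinearGroup (Fin 2) F with ¬ IsSquare (A.1.trace ^ 2 - 4), f A := by
  rw [Finset.sum_comm, Finset.mul_sum]
  refine Finset.sum_congr rfl fun e he => ?_
  have h := sum_commute_eq h2 (Finset.mem_filter.1 he).2 fun _ => 1
  rw [Finset.sum_const, card_commute h2 (Finset.mem_filter.1 he).2, nsmul_eq_mul] at h
  push_cast at h
  have h3 : ∀ A, (if A * e = e * A then f e else 0) =
      (if e * A = A * e then (1 : ℂ) else 0) * f e := by
    intro A
    simp [eq_comm]
  rw [Finset.sum_congr rfl fun A _ => h3 A, ← Finset.sum_mul]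
  linear_combination -f e * h

end Matrix.SpecialLinearGroup

namespace IsHalfDiscrete

open Matrix Matrix.SpecialLinearGroup

variable {F W : Type*} [Field F] [Fintype F] [AddCommGroup W] [Module ℂ W]
  {ρ : Matrix.SpecialLinearGroup (Fin 2) F →* Module.End ℂ W}

/-- The values of the character on a nonsplit torus. -/
theorem exists_generator_trace (h : IsHalfDiscrete ρ) {A : Matrix.SpecialLinearGroup (Fin 2) F}
    (hA : ¬ IsSquare (A.1.trace ^ 2 - 4)) :
    ∃ c, Subgroup.centralizer {A} = Subgroup.zpowers c ∧
      orderOf c = 2 * (Module.finrank ℂ W + 1) ∧ c ^ (Module.finrank ℂ W + 1) = -1 ∧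
      ∀ k, ¬ (Module.finrank ℂ W + 1) ∣ k → LinearMap.trace ℂ W (ρ (c ^ k)) = -(-1) ^ k := by
  have := h.finiteDimensional
  obtain ⟨d, hd⟩ : ∃ d, d = Module.finrank ℂ W := ⟨_, rfl⟩
  obtain ⟨D, hD⟩ : ∃ D, D = Finset.univ.filter fun A : Matrix.SpecialLinearGroup (Fin 2) F =>
    ¬ IsSquare (A.1.trace ^ 2 - 4) := ⟨_, rfl⟩
  choose! c r hc hcen hpow hr htr hprod using
    fun (A : Matrix.SpecialLinearGroup (Fin 2) F) (hA : ¬ IsSquare (A.1.trace ^ 2 - 4)) =>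
      h.exists_torus_eigenvalues hA
  obtain ⟨N, hN⟩ : ∃ N : Matrix.SpecialLinearGroup (Fin 2) F → ℕ, ∀ A, N A = (Finset.univ.filter
    fun p : Fin (Module.finrank ℂ W) × Fin (Module.finrank ℂ W) => r A p.1 = r A p.2).card :=
    ⟨_, fun _ => rfl⟩
  have hq := h.two_mul_finrank
  have hinner : ∀ A ∈ D, ∑ e ∈ D, (if A * e = e * A then normSq ρ e else 0) =
      (2 * (d + 1) * N A : ℕ) - (2 * d ^ 2 : ℕ) := by
    intro A hAD
    rw [hD, Finset.mem_filter] at hAD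
    have h1 := sum_commute_eq h.two_ne_zero hAD.2 (normSq ρ)
    rw [sum_normSq_torus (hc A hAD.2) (hcen A hAD.2) (hr A hAD.2) (htr A hAD.2), h.normSq_neg,
      normSq_one, ← hN, ← hd, ← hD] at h1
    push_cast at h1 ⊢
    linear_combination -h1
  have hsum := sum_nonsplit_sum_commute h.two_ne_zero (normSq ρ)
  rw [h.sum_normSq_nonsplit, ← hD, Finset.sum_congr rfl hinner, Finset.sum_sub_distrib,
    Finset.sum_const, nsmul_eq_mul, ← hq, ← hd] at hsum
  have hnat : ∑ A ∈ D, 2 * (d + 1) * N A =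
      2 * d * (2 * d ^ 2 * (2 * d + 1)) + D.card * (2 * d ^ 2) := by
    have : ((∑ A ∈ D, 2 * (d + 1) * N A : ℕ) : ℂ) =
        (2 * d * (2 * d ^ 2 * (2 * d + 1)) + D.card * (2 * d ^ 2) : ℕ) := by
      push_cast at hsum ⊢
      linear_combination hsum
    exact_mod_cast this
  have hcardD : 2 * d ^ 2 * (2 * d + 1) ≤ D.card := by
    have := h.card_nonsplit_ge
    rwa [← hD, ← hq, ← hd] at this
  have hle : ∀ A ∈ D, 2 * (d + 1) * d ≤ 2 * (d + 1) * N A := by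
    intro A _
    refine Nat.mul_le_mul_left _ ?_
    rw [hN, hd]
    simpa using Fintype.card_le_card_filter_eq (r A)
  have hAD : A ∈ D := by rw [hD]; simpa using hA
  have hNA : N A ≤ d := by
    by_contra hcon
    have hlt : 2 * (d + 1) * d < 2 * (d + 1) * N A :=
      Nat.mul_lt_mul_of_pos_left (by omega) (by omega)
    have h1 := Finset.sum_lt_sum hle ⟨A, hAD, hlt⟩
    rw [hnat, Finset.sum_const, smul_eq_mul] at h1
    have h3 := Nat.mul_le_mul_left (2 * d) hcardD
    nlinarith
  have hinj : Function.Injective (r A) := by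
    apply Function.injective_of_card_filter_eq_le
    rw [← hN, Fintype.card_fin, ← hd]
    exact hNA
  have heven : Even (Module.finrank ℂ W + 1) := by
    have := h.card_mod_four
    rw [Nat.even_iff]
    omega
  refine ⟨c A, hcen A hA, hc A hA, hpow A hA, fun k hk => ?_⟩
  rw [htr A hA, Complex.sum_pow_of_injective_of_prod_eq_one heven rfl hinj (hr A hA)
    (hprod A hA) hk]

end IsHalfDiscrete

namespace Matrix.SpecialLinearGroup

open Matrix

variable {F : Type*} [Field F]

theorem transvection_pow (x : F) (n : ℕ) :
    transvection (zero_ne_one (α := Fin 2)) x ^ n =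
      transvection (zero_ne_one (α := Fin 2)) ((n : F) * x) := by
  induction n with
  | zero =>
    ext i j
    fin_cases i <;> fin_cases j <;> simp
  | succ n ih =>
    rw [pow_succ, ih]
    ext i j
    fin_cases i <;> fin_cases j <;>
      simp [transvection_coe, Matrix.mul_apply, Fin.sum_univ_two, add_mul, add_comm]

theorem transvection_ne_neg_one (h2 : (2 : F) ≠ 0) (x : F) :
    transvection (zero_ne_one (α := Fin 2)) x ≠ -1 := by
  intro h
  have h1 := congrArg (fun B => B.1 0 0) h
  simp [transvection_coe] at h1
  exact h2 (by linear_combination h1)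

theorem eq_one_of_trace_eq_two (h2 : (2 : F) ≠ 0) {A : SpecialLinearGroup (Fin 2) F} {n : ℕ}
    (hn : (n : F) ≠ 0) (hA : A ^ n = 1 ∨ A ^ n = -1) (ht : A.1.trace = 2) : A = 1 := by
  obtain ⟨v, hv, hAv⟩ := exists_eigenvector (A := A) (s := 1) (by rw [ht]; ring)
  rw [one_smul] at hAv
  obtain ⟨g, x, rfl⟩ := exists_conj_transvection_of_smul_eq hv hAv
  rw [conj_pow, transvection_pow] at hA
  have h1 : transvection (zero_ne_one (α := Fin 2)) ((n : F) * x) = 1 := by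
    rcases hA with hA | hA
    · rw [mul_inv_eq_one] at hA
      exact mul_eq_left.1 hA
    · exfalso
      apply transvection_ne_neg_one h2 ((n : F) * x)
      calc _ = g⁻¹ * (g * transvection (zero_ne_one (α := Fin 2)) ((n : F) * x) * g⁻¹) * g := by
            group
        _ = -1 := by rw [hA]; simp
  have h3 := congrArg (fun B => B.1 0 1) h1
  simp [transvection_coe, hn] at h3
  subst h3
  have h4 : transvection (zero_ne_one (α := Fin 2)) (0 : F) = 1 := by
    simp
  rw [h4]
  simp

theorem neg_pow_eq_or {A : SpecialLinearGroup (Fin 2) F} {n : ℕ}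
    (hA : A ^ n = 1 ∨ A ^ n = -1) : (-A) ^ n = 1 ∨ (-A) ^ n = -1 := by
  rcases Nat.even_or_odd n with hn | hn
  · rwa [hn.neg_pow]
  · rw [hn.neg_pow]
    rcases hA with hA | hA <;> simp [hA]

theorem eq_neg_one_of_trace_eq_neg_two (h2 : (2 : F) ≠ 0) {A : SpecialLinearGroup (Fin 2) F}
    {n : ℕ} (hn : (n : F) ≠ 0) (hA : A ^ n = 1 ∨ A ^ n = -1) (ht : A.1.trace = -2) :
    A = -1 := by
  have := eq_one_of_trace_eq_two h2 hn (neg_pow_eq_or hA) (by simp [ht])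
  rw [← this, neg_neg]

theorem diag2_sq_pow_eq_one {s : F} (hs : s ≠ 0) {n : ℕ}
    (h : diag2 s hs ^ n = 1 ∨ diag2 s hs ^ n = -1) : (s ^ 2) ^ n = 1 := by
  have hp : ∀ k, ∃ y, (diag2 s hs ^ k).1 = !![s ^ k, 0; 0, y] := by
    intro k
    induction k with
    | zero => exact ⟨1, by rw [pow_zero, pow_zero, coe_one, Matrix.one_fin_two]⟩
    | succ k ih =>
      obtain ⟨y, hy⟩ := ih
      refine ⟨y * s⁻¹, ?_⟩
      rw [pow_succ, coe_mul, hy, diag2_coe', pow_succ]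
      simp
  obtain ⟨y, hy⟩ := hp n
  rw [pow_right_comm]
  rcases h with h | h <;>
  · have h1 := congrArg (fun B => B 0 0) hy
    rw [h] at h1
    simp at h1
    rw [← h1]
    norm_num

end Matrix.SpecialLinearGroup

namespace IsHalfDiscrete

open Matrix Matrix.SpecialLinearGroup

variable {F W : Type*} [Field F] [Fintype F] [AddCommGroup W] [Module ℂ W]
  {ρ : Matrix.SpecialLinearGroup (Fin 2) F →* Module.End ℂ W}

/-- The character value at an element of prime order `ℓ` in `PSL(2, F)`. -/
theorem trace_of_prime_order (h : IsHalfDiscrete ρ) {ℓ : ℕ} (hℓ : ℓ.Prime)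
    (hF : (ℓ : F) ≠ 0) {A : Matrix.SpecialLinearGroup (Fin 2) F} (h1 : A ≠ 1) (h1' : A ≠ -1)
    (hA : A ^ ℓ = 1 ∨ A ^ ℓ = -1) :
    (ℓ ∣ Fintype.card F - 1 ∧ LinearMap.trace ℂ W (ρ A) = 0 ∧ (ℓ = 2 → IsSquare (-1 : F))) ∨
      (ℓ ∣ Module.finrank ℂ W + 1 ∧ ∃ k, ¬ (Module.finrank ℂ W + 1) ∣ k ∧
        (Module.finrank ℂ W + 1) ∣ k * ℓ ∧ LinearMap.trace ℂ W (ρ A) = -(-1) ^ k) := by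
  by_cases hsq : IsSquare (A.1.trace ^ 2 - 4)
  · left
    have ht : A.1.trace ≠ 2 := fun ht => h1 (eq_one_of_trace_eq_two h.two_ne_zero hF hA ht)
    have ht' : A.1.trace ≠ -2 :=
      fun ht => h1' (eq_neg_one_of_trace_eq_neg_two h.two_ne_zero hF hA ht)
    obtain ⟨g, s, hs0, hs2, hgs⟩ := exists_conj_diag2_of_isSquare h.two_ne_zero hsq ht ht'
    have hp : (s ^ 2) ^ ℓ = 1 := by
      apply diag2_sq_pow_eq_one hs0
      have h3 : diag2 s hs0 = g⁻¹ * A * g := by rw [hgs]; group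
      have h4 : diag2 s hs0 ^ ℓ = g⁻¹ * A ^ ℓ * g := by
        have := conj_pow (a := g⁻¹) (b := A) (i := ℓ)
        rw [inv_inv] at this
        rw [h3, this]
      rw [h4]
      rcases hA with hA | hA <;> rw [hA] <;> simp
    refine ⟨?_, h.trace_eq_zero_of_isSquare hsq ht ht', ?_⟩
    · have := Fact.mk hℓ
      rw [← orderOf_eq_prime hp hs2]
      exact orderOf_dvd_of_pow_eq_one (FiniteField.pow_card_sub_one_eq_one _ (pow_ne_zero 2 hs0))
    · rintro rfl
      refine ⟨s, ?_⟩
      have h5 : (s ^ 2 - 1) * (s ^ 2 + 1) = 0 := by linear_combination hp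
      rcases mul_eq_zero.1 h5 with h6 | h6
      · exact absurd (sub_eq_zero.1 h6) hs2
      · linear_combination -h6
  · right
    obtain ⟨c, hcen, hord, hneg, htr⟩ := h.exists_generator_trace hsq
    obtain ⟨k, rfl⟩ : ∃ k : ℕ, c ^ k = A := by
      have : A ∈ Subgroup.zpowers c := by
        rw [← hcen, Subgroup.mem_centralizer_singleton_iff]
      exact mem_powers_iff_mem_zpowers.2 this
    have hk : ¬ (Module.finrank ℂ W + 1) ∣ k := by
      rintro ⟨j, rfl⟩
      rw [pow_mul, hneg] at h1 h1'
      rcases neg_one_pow_eq_or (Matrix.SpecialLinearGroup (Fin 2) F) j with h | h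
      · exact h1 h
      · exact h1' h
    have hkl : (Module.finrank ℂ W + 1) ∣ k * ℓ := by
      have h3 : c ^ (2 * (k * ℓ)) = 1 := by
        rw [mul_comm, pow_mul, pow_mul]
        rcases hA with hA | hA <;> rw [hA] <;> simp
      have := orderOf_dvd_of_pow_eq_one h3
      rw [hord] at this
      exact Nat.dvd_of_mul_dvd_mul_left two_pos this
    refine ⟨?_, k, hk, hkl, htr k hk⟩
    by_contra hcon
    exact hk (((hℓ.coprime_iff_not_dvd).2 hcon).symm.dvd_of_dvd_mul_right hkl)

theorem trace_of_odd_prime_order (h : IsHalfDiscrete ρ) {ℓ : ℕ} (hℓ : ℓ.Prime) (hodd : Odd ℓ)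
    (hF : (ℓ : F) ≠ 0) {A : Matrix.SpecialLinearGroup (Fin 2) F} (h1 : A ≠ 1) (h1' : A ≠ -1)
    (hA : A ^ ℓ = 1 ∨ A ^ ℓ = -1) :
    (ℓ ∣ Fintype.card F - 1 ∧ LinearMap.trace ℂ W (ρ A) = 0) ∨
      (ℓ ∣ Fintype.card F + 1 ∧ LinearMap.trace ℂ W (ρ A) = -1) := by
  rcases h.trace_of_prime_order hℓ hF h1 h1' hA with ⟨h3, h4, -⟩ | ⟨h3, k, -, h5, h6⟩
  · exact Or.inl ⟨h3, h4⟩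
  · right
    have hq := h.two_mul_finrank
    have h4 := h.card_mod_four
    refine ⟨?_, ?_⟩
    · rw [← hq, show 2 * Module.finrank ℂ W + 1 + 1 = 2 * (Module.finrank ℂ W + 1) by ring]
      exact h3.mul_left 2
    · have h2 : 2 ∣ k * ℓ := (by omega : 2 ∣ Module.finrank ℂ W + 1).trans h5
      have hk : Even k := by
        rcases Nat.even_mul.1 (even_iff_two_dvd.2 h2) with hk | hk
        · exact hk
        · exact absurd hk (Nat.not_even_iff_odd.2 hodd)
      rw [h6, hk.neg_one_pow]

theorem trace_of_involution (h : IsHalfDiscrete ρ) (h8 : Fintype.card F % 8 = 3)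
    {A : Matrix.SpecialLinearGroup (Fin 2) F} (h1 : A ≠ 1) (h1' : A ≠ -1)
    (hA : A ^ 2 = 1 ∨ A ^ 2 = -1) : LinearMap.trace ℂ W (ρ A) = 1 := by
  have h2 : ((2 : ℕ) : F) ≠ 0 := by exact_mod_cast h.two_ne_zero
  rcases h.trace_of_prime_order Nat.prime_two h2 h1 h1' hA with ⟨-, -, h3⟩ | ⟨-, k, h4, h5, h6⟩
  · exact absurd (h3 rfl) h.not_isSquare_neg_one
  · have hq := h.two_mul_finrank
    have hk : Odd k := by
      by_contra hk
      obtain ⟨j, rfl⟩ := (Nat.not_odd_iff_even.1 hk).two_dvd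
      obtain ⟨m, hm⟩ : 2 ∣ Module.finrank ℂ W + 1 := by omega
      have hm2 : ¬ 2 ∣ m := by omega
      apply h4
      rw [hm] at h5 ⊢
      have h7 : m ∣ j * 2 := by
        rw [mul_assoc] at h5
        exact Nat.dvd_of_mul_dvd_mul_left two_pos h5
      exact Nat.mul_dvd_mul_left 2
        (((Nat.prime_two.coprime_iff_not_dvd).2 hm2).symm.dvd_of_dvd_mul_right h7)
    rw [h6, hk.neg_one_pow, neg_neg]

end IsHalfDiscrete

/-- Averaging over a finite group can be done upstairs along a surjective homomorphism. -/
theorem MonoidHom.card_mul_sum_comp {S G : Type*} [Group S] [Fintype S] [Group G] [Fintype G]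
    (f : S →* G) (hf : Function.Surjective f) (φ : G → ℂ) :
    (Fintype.card G : ℂ) * ∑ A, φ (f A) = Fintype.card S * ∑ g, φ g := by
  have key : ∀ φ : G → ℂ, ∑ A, φ (f A) =
      ((Finset.univ.filter fun A => f A = 1).card : ℂ) * ∑ g, φ g := by
    intro φ
    rw [← Finset.sum_fiberwise_of_maps_to (g := f) (t := Finset.univ) (by simp), Finset.mul_sum]
    refine Finset.sum_congr rfl fun g _ => ?_
    rw [Finset.sum_congr rfl (g := fun _ => φ g) (by
      intro A hA
      rw [(Finset.mem_filter.1 hA).2]), Finset.sum_const, nsmul_eq_mul,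
      MonoidHom.card_fiber_eq_of_mem_range f (hf g) (hf 1)]
  have h1 := key fun _ => 1
  simp only [Finset.sum_const, Finset.card_univ, nsmul_eq_mul, mul_one] at h1
  rw [key φ, h1]
  ring

namespace Matrix.SpecialLinearGroup

variable {F : Type} [Field F]

theorem neg_one_mem_center : (-1 : SpecialLinearGroup (Fin 2) F) ∈
    Subgroup.center (SpecialLinearGroup (Fin 2) F) := by
  rw [Subgroup.mem_center_iff]
  intro g
  simp

theorem eq_one_or_eq_neg_one_of_mem_center {A : SpecialLinearGroup (Fin 2) F}
    (hA : A ∈ Subgroup.center (SpecialLinearGroup (Fin 2) F)) : A = 1 ∨ A = -1 := by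
  obtain ⟨r, hr, h⟩ := Matrix.SpecialLinearGroup.mem_center_iff.1 hA
  rw [Fintype.card_fin] at hr
  rcases mul_self_eq_one_iff.1 ((sq r).symm.trans hr) with rfl | rfl
  · exact Or.inl (Subtype.ext (by rw [← h]; simp))
  · exact Or.inr (Subtype.ext (by rw [← h, map_neg, map_one, coe_neg, coe_one]))

end Matrix.SpecialLinearGroup

/-- Inflating an irreducible character of `PSL(2, F)` of degree `(q - 1) / 2` to `SL(2, F)`. -/
theorem isHalfDiscrete_of_simple {F : Type} [Field F] [Fintype F] (V : FDRep ℂ (PSL2 F))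
    [CategoryTheory.Simple V] (h4 : Fintype.card F % 4 = 3) (h3 : 3 < Fintype.card F)
    (hdeg : V.character 1 = ((Fintype.card F : ℂ) - 1) / 2) :
    IsHalfDiscrete (V.ρ.comp
      (QuotientGroup.mk' (Subgroup.center (Matrix.SpecialLinearGroup (Fin 2) F)))) where
  map_neg_one := by
    rw [MonoidHom.comp_apply, QuotientGroup.mk'_apply, (QuotientGroup.eq_one_iff _).2
      Matrix.SpecialLinearGroup.neg_one_mem_center, map_one]
  two_mul_finrank := by
    rw [FDRep.char_one] at hdeg
    have : ((2 * Module.finrank ℂ V + 1 : ℕ) : ℂ) = Fintype.card F := by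
      push_cast
      rw [hdeg]
      ring
    exact_mod_cast this
  sum_trace := by
    have hcard : (Fintype.card (PSL2 F) : ℂ) ≠ 0 := by exact_mod_cast Fintype.card_ne_zero
    have : Invertible (Nat.card (PSL2 F) : ℂ) := by
      rw [Nat.card_eq_fintype_card]
      exact invertibleOfNonzero hcard
    have horth := FDRep.char_orthonormal V V
    rw [if_pos ⟨CategoryTheory.Iso.refl V⟩] at horth
    have hsum := MonoidHom.card_mul_sum_comp
      (QuotientGroup.mk' (Subgroup.center (Matrix.SpecialLinearGroup (Fin 2) F)))
      (QuotientGroup.mk'_surjective _) fun g => V.character g * V.character g⁻¹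
    have hG : ∑ g, V.character g * V.character g⁻¹ = Fintype.card (PSL2 F) := by
      rw [Nat.card_eq_fintype_card] at horth
      exact (inv_mul_eq_one₀ hcard).1 horth |>.symm
    rw [hG, mul_comm] at hsum
    exact mul_right_cancel₀ hcard hsum
  card_mod_four := h4
  three_lt_card := h3

theorem restMult_of_const {G : Type} [Group G] [Finite G] {H : Subgroup G} {θ : H →* ℂˣ}
    (hθ : θ ≠ 1) {χ : G → ℂ} {v : ℂ} (hv : ∀ h ∈ H, h ≠ 1 → χ h = v) :
    restMult H θ χ = (χ 1 - v) / Nat.card H := by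
  let _ : Fintype H := Fintype.ofFinite H
  have h0 : ∑ h : H, ((θ h : ℂ))⁻¹ = 0 := by
    have hf : (Units.coeHom ℂ).comp θ⁻¹ ≠ 1 := by
      intro h
      apply hθ
      ext x
      have h1 := DFunLike.congr_fun h x
      simpa using h1
    rw [← sum_hom_units_eq_zero _ hf]
    simp
  have h1 : ∀ h : H, χ h * ((θ h : ℂ))⁻¹ =
      v * ((θ h : ℂ))⁻¹ + if h = 1 then χ 1 - v else 0 := by
    intro h
    by_cases hh : h = 1
    · subst hh
      simp
    · rw [if_neg hh, hv h h.2 (by simpa using hh), add_zero]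
  have h2 : ∑ h : H, χ h * ((θ h : ℂ))⁻¹ = χ 1 - v := by
    rw [Finset.sum_congr rfl fun h _ => h1 h, Finset.sum_add_distrib, ← Finset.mul_sum, h0]
    simp
  rw [div_eq_inv_mul, ← h2]
  rfl

theorem pow_ne_one_of_injective {H : Type*} [Group H] [Finite H] {θ : H →* ℂˣ}
    (hθ : Function.Injective θ) {p k : ℕ} (hp : p.Prime) (hH : Nat.card H = p)
    (hk : ¬ p ∣ k) : θ ^ k ≠ 1 := by
  intro h
  have := Fact.mk hp
  obtain ⟨x, hx⟩ := exists_prime_orderOf_dvd_card' p (G := H) (by rw [hH])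
  apply hk
  rw [← hx, ← orderOf_injective θ hθ]
  exact orderOf_dvd_of_pow_eq_one (by simpa using DFunLike.congr_fun h x)

theorem ne_one_of_injective {H : Type*} [Group H] [Finite H] {θ : H →* ℂˣ}
    (hθ : Function.Injective θ) {p : ℕ} (hp : p.Prime) (hH : Nat.card H = p) : θ ≠ 1 := by
  intro h
  refine pow_ne_one_of_injective (k := 1) hθ hp hH (by simpa using hp.ne_one) ?_
  ext
  simp [h]

theorem PSL2.exists_lift_of_mem {F : Type} [Field F] {H : Subgroup (PSL2 F)}
    {h : PSL2 F} (hh : h ∈ H) (h1 : h ≠ 1) :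
    ∃ A : Matrix.SpecialLinearGroup (Fin 2) F, (A : PSL2 F) = h ∧ A ≠ 1 ∧ A ≠ -1 ∧
      (A ^ Nat.card H = 1 ∨ A ^ Nat.card H = -1) := by
  obtain ⟨A, rfl⟩ := QuotientGroup.mk_surjective h
  refine ⟨A, rfl, ?_, ?_, ?_⟩
  · rintro rfl
    exact h1 rfl
  · rintro rfl
    exact h1 ((QuotientGroup.eq_one_iff _).2 Matrix.SpecialLinearGroup.neg_one_mem_center)
  · apply Matrix.SpecialLinearGroup.eq_one_or_eq_neg_one_of_mem_center
    rw [← QuotientGroup.eq_one_iff, QuotientGroup.mk_pow]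
    exact congrArg Subtype.val (pow_card_eq_one' (x := (⟨_, hh⟩ : H)))

theorem IsHalfDiscrete.value_of_odd_prime {F : Type} [Field F] [Fintype F] {W : Type*}
    [AddCommGroup W] [Module ℂ W] {ρ : PSL2 F →* Module.End ℂ W}
    (h : IsHalfDiscrete (ρ.comp
      (QuotientGroup.mk' (Subgroup.center (Matrix.SpecialLinearGroup (Fin 2) F)))))
    {H : Subgroup (PSL2 F)} {p : ℕ} (hp : p.Prime) (hodd : Odd p) (hF : (p : F) ≠ 0)
    (hH : Nat.card H = p) {x : PSL2 F} (hx : x ∈ H) (hx1 : x ≠ 1) :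
    (p ∣ Fintype.card F - 1 ∧ LinearMap.trace ℂ W (ρ x) = 0) ∨
      (p ∣ Fintype.card F + 1 ∧ LinearMap.trace ℂ W (ρ x) = -1) := by
  obtain ⟨A, rfl, h1, h1', hA⟩ := PSL2.exists_lift_of_mem hx hx1
  exact h.trace_of_odd_prime_order hp hodd hF h1 h1' (hH ▸ hA)

theorem ramMult_of_const {G : Type} [Group G] [Finite G] {H2 H3 H7 : Subgroup G}
    (hH2 : Nat.card H2 = 2) (hH3 : Nat.card H3 = 3) (hH7 : Nat.card H7 = 7)
    {θ2 : H2 →* ℂˣ} {θ3 : H3 →* ℂˣ} {θ7 : H7 →* ℂˣ}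
    (hθ2 : Function.Injective θ2) (hθ3 : Function.Injective θ3) (hθ7 : Function.Injective θ7)
    {χ : G → ℂ} {v2 v3 v7 : ℂ} (h2 : ∀ h ∈ H2, h ≠ 1 → χ h = v2)
    (h3 : ∀ h ∈ H3, h ≠ 1 → χ h = v3) (h7 : ∀ h ∈ H7, h ≠ 1 → χ h = v7) :
    ramMult H2 H3 H7 θ2 θ3 θ7 χ =
      (χ 1 - v2) / 4 + (χ 1 - v3) / 3 + 3 * ((χ 1 - v7) / 7) := by
  have r2 := restMult_of_const
    (ne_one_of_injective hθ2 Nat.prime_two hH2) h2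
  have r3 := restMult_of_const
    (ne_one_of_injective hθ3 Nat.prime_three hH3) h3
  have r3' := restMult_of_const
    (pow_ne_one_of_injective (k := 2) hθ3 Nat.prime_three hH3 (by norm_num)) h3
  have r7 : ∀ k ∈ Finset.Icc (1 : ℕ) 6, (k : ℂ) * restMult H7 (θ7 ^ k) χ =
      (k : ℂ) * ((χ 1 - v7) / Nat.card H7) := by
    intro k hk
    rw [Finset.mem_Icc] at hk
    rw [restMult_of_const (pow_ne_one_of_injective hθ7 (by norm_num) hH7
      (fun hd => absurd (Nat.le_of_dvd (by omega) hd) (by omega))) h7]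
  have hsum : ∑ k ∈ Finset.Icc (1 : ℕ) 6, (k : ℂ) = 21 := by
    norm_num [Finset.sum_Icc_succ_top]
  rw [ramMult, r2, r3, r3', Finset.sum_congr rfl r7, ← Finset.sum_mul, hsum, hH2, hH3, hH7]
  push_cast
  ring

theorem natCast_ne_zero_of_coprime {F : Type*} [Field F] [Fintype F] {n : ℕ}
    (h : Nat.Coprime (Fintype.card F) n) : (n : F) ≠ 0 := by
  intro h0
  obtain ⟨p, hp⟩ := CharP.exists F
  have hp1 : p ∣ n := (CharP.cast_eq_zero_iff F p n).1 h0
  have hp2 : p ∣ Fintype.card F :=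
    (CharP.cast_eq_zero_iff F p _).1 (FiniteField.cast_card_eq_zero F)
  have := Nat.dvd_gcd hp2 hp1
  rw [h] at this
  exact CharP.ringChar_ne_one (R := F) (by rw [ringChar.eq F p]; exact Nat.dvd_one.1 this)

theorem ramification_module_q3mod8
    (q : ℕ) (hq : IsPrimePow q) (hgcd : Nat.Coprime q 42)
    (hq7 : q % 7 = 1 ∨ q % 7 = 6)
    (F : Type) [Field F] [Fintype F] (hF : Fintype.card F = q)
    (H2 H3 H7 : Subgroup (PSL2 F))
    (hH2 : Nat.card H2 = 2) (hH3 : Nat.card H3 = 3) (hH7 : Nat.card H7 = 7)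
    (θ2 : H2 →* ℂˣ) (θ3 : H3 →* ℂˣ) (θ7 : H7 →* ℂˣ)
    (hθ2 : Function.Injective θ2) (hθ3 : Function.Injective θ3)
    (hθ7 : Function.Injective θ7)
    (hq8 : q % 8 = 3)
    (χ : PSL2 F → ℂ) (hχ : IsIrrCharacter (PSL2 F) χ) (hdeg : χ 1 = ((q : ℂ) - 1) / 2)
    :
    ramMult H2 H3 H7 θ2 θ3 θ7 χ = ((baseMult q : ℂ) - 1) / 2 := by
  subst hF
  obtain ⟨V, hV, rfl⟩ := hχ
  have hq3 : Fintype.card F % 3 ≠ 0 := by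
    intro h
    have := Nat.dvd_gcd (Nat.dvd_of_mod_eq_zero h) (by norm_num : 3 ∣ 42)
    rw [hgcd] at this
    omega
  have h := isHalfDiscrete_of_simple V (by omega) (by omega) hdeg
  have hF3 : ((3 : ℕ) : F) ≠ 0 :=
    natCast_ne_zero_of_coprime (hgcd.coprime_dvd_right (by norm_num))
  have hF7 : ((7 : ℕ) : F) ≠ 0 :=
    natCast_ne_zero_of_coprime (hgcd.coprime_dvd_right (by norm_num))
  have v2 : ∀ x ∈ H2, x ≠ 1 → V.character x = 1 := by
    intro x hx hx1
    obtain ⟨A, rfl, h1, h1', hA⟩ := PSL2.exists_lift_of_mem hx hx1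
    exact h.trace_of_involution hq8 h1 h1' (by rwa [hH2] at hA)
  have v3 : ∀ x ∈ H3, x ≠ 1 → V.character x = if Fintype.card F % 3 = 1 then 0 else -1 := by
    intro x hx hx1
    rcases h.value_of_odd_prime Nat.prime_three (by decide) hF3 hH3 hx hx1 with ⟨h1, h2⟩ | ⟨h1, h2⟩
    · rw [if_pos (by omega)]
      exact h2
    · rw [if_neg (by omega)]
      exact h2
  have v7 : ∀ x ∈ H7, x ≠ 1 → V.character x = if Fintype.card F % 7 = 1 then 0 else -1 := by
    intro x hx hx1
    rcases h.value_of_odd_prime (by norm_num : Nat.Prime 7) (by decide) hF7 hH7 hx hx1 with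
      ⟨h1, h2⟩ | ⟨h1, h2⟩
    · rw [if_pos (by omega)]
      exact h2
    · rw [if_neg (by omega)]
      exact h2
  rw [ramMult_of_const hH2 hH3 hH7 hθ2 hθ3 hθ7 v2 v3 v7, hdeg, baseMult,
    if_neg (by omega : ¬ Fintype.card F % 4 = 1)]
  obtain ⟨q, hqq⟩ : ∃ q : ℤ, q = Fintype.card F := ⟨_, rfl⟩
  obtain ⟨e3, he3⟩ : ∃ e : ℤ, e = if Fintype.card F % 3 = 1 then 1 else -1 := ⟨_, rfl⟩
  obtain ⟨e7, he7⟩ : ∃ e : ℤ, e = if Fintype.card F % 7 = 1 then 1 else -1 := ⟨_, rfl⟩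
  have hv3 : (if Fintype.card F % 3 = 1 then (0 : ℂ) else -1) = (e3 - 1) / 2 := by
    rw [he3]
    split_ifs <;> norm_num
  have hv7 : (if Fintype.card F % 7 = 1 then (0 : ℂ) else -1) = (e7 - 1) / 2 := by
    rw [he7]
    split_ifs <;> norm_num
  have hqc : (Fintype.card F : ℂ) = q := by rw [hqq]; norm_cast
  obtain ⟨a, ha⟩ : ∃ a : ℤ, q - -1 = 4 * a := ⟨(q + 1) / 4, by omega⟩
  obtain ⟨b, hb⟩ : ∃ b : ℤ, q - e3 = 3 * b := ⟨(q - e3) / 3, by split_ifs at he3 <;> omega⟩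
  obtain ⟨c, hc⟩ : ∃ c : ℤ, q - e7 = 7 * c := ⟨(q - e7) / 7, by split_ifs at he7 <;> omega⟩
  rw [hv3, hv7, hqc, ← he3, ← he7, ← hqq, ha, hb, hc, Int.mul_ediv_cancel_left _ (by norm_num),
    Int.mul_ediv_cancel_left _ (by norm_num), Int.mul_ediv_cancel_left _ (by norm_num)]
  have hac : (q : ℂ) - -1 = 4 * a := by exact_mod_cast ha
  have hbc : (q : ℂ) - e3 = 3 * b := by exact_mod_cast hb
  have hcc : (q : ℂ) - e7 = 7 * c := by exact_mod_cast hc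
  push_cast
  linear_combination hac / 8 + hbc / 6 + 3 * hcc / 14
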